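/- arXiv:2507.05793 — 2 statements merged into one kernel-verified Lean document; each statement's English description precedes it below -/
import Mathlib

section
/- Doob–Hunt convergence: for a transient Markov chain {Y_n} with initial distribution μ satisfying G(μ,y)>0 for all y, and any fixed state x, the Martin kernel sequence M(x,Y_n) = G(x,Y_n)/G(μ,Y_n) converges almost surely as n→∞, and E[M(x,Y_n)] → 1. -/
open scoped Classical
open Filter Topology MeasureTheory ProbabilityTheory

/-- `n`-step transition probabilities of the Markov chain with one-step kernel `q`. -/
noncomputable def qstep {S : Type*} (q : S → S → ℝ) : ℕ → S → S → ℝ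
  | 0, x, y => if x = y then 1 else 0
  | n + 1, x, y => ∑' z, qstep q n x z * q z y

/-- Green kernel `G(x,y) = Σ_n q^n(x,y)` of the chain. -/
noncomputable def GreenQ {S : Type*} (q : S → S → ℝ) (x y : S) : ℝ := ∑' n, qstep q n x y

/-- `P` is the law of the Markov chain with initial distribution `μ` and transition
probabilities `q`, as a measure on trajectory space. -/
def IsChainLaw {S : Type*} [MeasurableSpace S] (μ : S → ℝ) (q : S → S → ℝ)
    (P : MeasureTheory.Measure (ℕ → S)) : Prop :=
  ∀ (n : ℕ) (v : ℕ → S),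
    P {ω | ∀ i ≤ n, ω i = v i} =
      ENNReal.ofReal (μ (v 0) * ∏ i ∈ Finset.range n, q (v i) (v (i + 1)))

open scoped ENNReal

namespace DH

variable {S : Type*}

/-- `X` depends only on the coordinates up to time `n`. -/
def Adap (n : ℕ) {β : Type*} (X : (ℕ → S) → β) : Prop :=
  ∀ ω ω' : ℕ → S, (∀ i ≤ n, ω i = ω' i) → X ω = X ω'

lemma Adap.mono {n m : ℕ} {β : Type*} {X : (ℕ → S) → β} (h : Adap n X) (hnm : n ≤ m) :
    Adap m X := fun ω ω' hh => h ω ω' fun i hi => hh i (hi.trans hnm)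

/-- transition operator -/
noncomputable def op (Q : S → S → ℝ≥0∞) (u : S → ℝ≥0∞) : S → ℝ≥0∞ :=
  fun y => ∑' z, Q y z * u z

/-- point indicator -/
noncomputable def ind (z : S) : S → ℝ≥0∞ := fun y => if y = z then 1 else 0

/-- Markov property. -/
def MarkovE [MeasurableSpace S] (Q : S → S → ℝ≥0∞) (P : Measure (ℕ → S)) : Prop :=
  ∀ (n : ℕ) (X : (ℕ → S) → ℝ≥0∞), Adap n X → ∀ u : S → ℝ≥0∞,
    ∫⁻ ω, X ω * u (ω (n + 1)) ∂P = ∫⁻ ω, X ω * op Q u (ω n) ∂P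

lemma op_ind (Q : S → S → ℝ≥0∞) (y z : S) : op Q (ind z) y = Q y z := by
  unfold op ind
  rw [tsum_eq_single z]
  · simp
  · intro b hb; simp [hb]

lemma sum_ind (u : S → ℝ≥0∞) (y : S) : ∑' w, ind w y * u w = u y := by
  unfold ind
  rw [tsum_eq_single y]
  · simp
  · intro b hb; simp [hb.symm]

section flow

variable (Q : S → S → ℝ≥0∞) (l : ℕ → S → ℝ≥0∞)

/-- flow of measures -/
def Flow : Prop := ∀ n z, l (n + 1) z = ∑' w, l n w * Q w z

variable {Q l}

lemma Flow.pair (hl : Flow Q l) (n : ℕ) (u : S → ℝ≥0∞) :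
    ∑' w, l (n + 1) w * u w = ∑' w, l n w * op Q u w := by
  simp only [hl n, op, ← ENNReal.tsum_mul_right, ← ENNReal.tsum_mul_left]
  rw [ENNReal.tsum_comm]
  simp only [mul_assoc]

lemma Flow.pair_iter (hl : Flow Q l) (n m : ℕ) (u : S → ℝ≥0∞) :
    ∑' w, l n w * ((op Q)^[m] u) w = ∑' w, l (n + m) w * u w := by
  induction m generalizing u with
  | zero => simp
  | succ m ih =>
    rw [Function.iterate_succ_apply, ih, ← add_assoc, hl.pair]

lemma Flow.sum_eq (hl : Flow Q l) (z : S) :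
    ∑' n, l n z = l 0 z + ∑' w, (∑' n, l n w) * Q w z := by
  rw [tsum_eq_zero_add' ENNReal.summable]
  congr 1
  simp only [hl _ z, ← ENNReal.tsum_mul_right]
  rw [ENNReal.tsum_comm]

/-- potential of a finite set -/
noncomputable def pot (Q : S → S → ℝ≥0∞) (K : Finset S) (y : S) : ℝ≥0∞ :=
  ∑' n, ((op Q)^[n] (fun z => if z ∈ K then 1 else 0)) y

noncomputable def hK (Q : S → S → ℝ≥0∞) (K : Finset S) (y : S) : ℝ≥0∞ := min 1 (pot Q K y)

noncomputable def cK (Q : S → S → ℝ≥0∞) (K : Finset S) (y : S) : ℝ≥0∞ :=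
  hK Q K y - op Q (hK Q K) y

lemma op_mono {u v : S → ℝ≥0∞} (h : ∀ y, u y ≤ v y) (y : S) : op Q u y ≤ op Q v y :=
  ENNReal.tsum_le_tsum fun z => by gcongr; exact h z

lemma hK_le_one (K : Finset S) (y : S) : hK Q K y ≤ 1 := min_le_left _ _

lemma hK_eq_one (K : Finset S) (y : S) (hy : y ∈ K) : hK Q K y = 1 := by
  refine min_eq_left ?_
  refine le_trans ?_ (ENNReal.le_tsum 0)
  simp [hy]

lemma op_pot_le (K : Finset S) (y : S) : op Q (pot Q K) y ≤ pot Q K y := by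
  unfold pot
  rw [tsum_eq_zero_add' (f := fun n => ((op Q)^[n] (fun z => if z ∈ K then 1 else 0)) y)
    ENNReal.summable]
  refine le_trans (le_of_eq ?_) le_add_self
  simp only [Function.iterate_succ_apply']
  simp only [op, ← ENNReal.tsum_mul_left]
  rw [ENNReal.tsum_comm]

lemma op_hK_le (hQ : ∀ y, ∑' z, Q y z = 1) (K : Finset S) (y : S) :
    op Q (hK Q K) y ≤ hK Q K y := by
  refine le_min ?_ ?_
  · refine (op_mono (v := fun _ => 1) (fun z => hK_le_one K z) y).trans ?_
    simp [op, hQ]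
  · exact (op_mono (fun z => min_le_right _ _) y).trans (op_pot_le K y)

lemma cK_add (hQ : ∀ y, ∑' z, Q y z = 1) (K : Finset S) (y : S) :
    cK Q K y + op Q (hK Q K) y = hK Q K y :=
  tsub_add_cancel_of_le (op_hK_le hQ K y)

lemma Flow.telescope (hl : Flow Q l) (hQ : ∀ y, ∑' z, Q y z = 1)
    (hfin : ∀ z, ∑' n, l n z ≠ ∞) (K : Finset S) :
    ∑' n, ∑' w, l n w * cK Q K w = ∑' w, l 0 w * hK Q K w := by
  have h1 : ∀ R : ℕ, ∑ n ∈ Finset.range R, ∑' w, l n w * cK Q K w + ∑' w, l R w * hK Q K w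
      = ∑' w, l 0 w * hK Q K w := by
    intro R
    induction R with
    | zero => simp
    | succ R ih =>
      rw [← ih, Finset.sum_range_succ, add_assoc, hl.pair, ← ENNReal.tsum_add]
      simp only [← mul_add, cK_add hQ]
  have h2 : Tendsto (fun R => ∑' w, l R w * hK Q K w) atTop (𝓝 0) := by
    have hf : ∑' n, ∑' w, l n w * (if w ∈ K then 1 else 0) ≠ ∞ := by
      rw [ENNReal.tsum_comm]
      simp only [ENNReal.tsum_mul_right]
      rw [tsum_eq_sum (s := K)]
      · refine (ENNReal.sum_lt_top.2 fun z hz => ?_).ne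
        simp [hz, (hfin z).lt_top]
      · intro b hb; simp [hb]
    refine tendsto_of_tendsto_of_tendsto_of_le_of_le tendsto_const_nhds
      (ENNReal.tendsto_sum_nat_add _ hf) (fun _ => zero_le) ?_
    intro R
    show ∑' w, l R w * hK Q K w ≤ _
    calc ∑' w, l R w * hK Q K w ≤ ∑' w, l R w * pot Q K w :=
          ENNReal.tsum_le_tsum fun w => by gcongr; exact min_le_right _ _
      _ = ∑' n, ∑' w, l R w * ((op Q)^[n] (fun z => if z ∈ K then 1 else 0)) w := by
          simp only [pot, ← ENNReal.tsum_mul_left]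
          rw [ENNReal.tsum_comm]
      _ ≤ _ := by
          refine le_of_eq (tsum_congr fun n => ?_)
          rw [hl.pair_iter, add_comm]
  have h3 := (ENNReal.tendsto_nat_tsum (fun n => ∑' w, l n w * cK Q K w)).add h2
  simp only [h1, add_zero] at h3
  exact tendsto_nhds_unique h3 tendsto_const_nhds

/-- domination principle: `v` excessive with `t * G(x) ≤ v`, at the base point -/
lemma Flow.dominate {x : S} (hl : Flow Q l) (h0 : ∀ z, l 0 z = ind x z)
    (v : S → ℝ≥0∞) (hv : ∀ z, ∑' w, v w * Q w z ≤ v z) (t : ℝ≥0∞)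
    (ht : t * ∑' n, l n x ≤ v x) (z : S) : t * ∑' n, l n z ≤ v z := by
  set s : S → ℝ≥0∞ := fun z => min (v z) (t * ∑' n, l n z) with hs
  have key : ∀ z, t * ind x z + ∑' w, s w * Q w z ≤ s z := by
    intro z
    have e1 : t * ind x z + ∑' w, s w * Q w z ≤ t * ∑' n, l n z := by
      rw [hl.sum_eq z, h0, mul_add, ← ENNReal.tsum_mul_left]
      refine add_le_add le_rfl (ENNReal.tsum_le_tsum fun w => ?_)
      rw [← mul_assoc]
      gcongr
      exact min_le_right _ _
    refine le_min ?_ e1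
    by_cases hz : z = x
    · subst hz; exact e1.trans ht
    · simp only [ind, hz, if_false, mul_zero, zero_add]
      refine le_trans (ENNReal.tsum_le_tsum fun w => ?_) (hv z)
      gcongr
      exact min_le_left _ _
  have h2 : ∀ N z, t * ∑ n ∈ Finset.range N, l n z ≤ s z := by
    intro N
    induction N with
    | zero => simp
    | succ N ih =>
      intro z
      refine le_trans ?_ (key z)
      rw [Finset.sum_range_succ', h0, mul_add, add_comm]
      gcongr
      simp only [hl _ z]
      rw [← Summable.tsum_finsetSum (fun _ _ => ENNReal.summable), ← ENNReal.tsum_mul_left]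
      refine ENNReal.tsum_le_tsum fun w => ?_
      rw [← Finset.sum_mul, ← mul_assoc]
      gcongr
      exact ih w
  rw [ENNReal.tsum_eq_iSup_nat, ENNReal.mul_iSup]
  exact iSup_le fun N => (h2 N z).trans (min_le_left _ _)

end flow

section markov

set_option linter.unusedSectionVars false

variable [Countable S] [MeasurableSpace S] [DiscreteMeasurableSpace S]
  {Q : S → S → ℝ≥0∞} {P : Measure (ℕ → S)}

lemma Adap.measurable {n : ℕ} {X : (ℕ → S) → ℝ≥0∞} (hX : Adap n X) : Measurable X := by
  rcases isEmpty_or_nonempty (ℕ → S) with h | ⟨⟨o⟩⟩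
  · exact measurable_of_empty _
  let R : (ℕ → S) → (Fin (n + 1) → S) := fun ω i => ω i
  have hR : Measurable R := by fun_prop
  let E : (Fin (n + 1) → S) → (ℕ → S) := fun v i => if h : i < n + 1 then v ⟨i, h⟩ else o 0
  have : X = (fun v => X (E v)) ∘ R := by
    funext ω
    refine hX _ _ fun i hi => ?_
    have : i < n + 1 := by omega
    simp only [E, R, this, dif_pos]
  rw [this]
  exact (measurable_of_countable _).comp hR

lemma markov_of_law {μ : S → ℝ} {q : S → S → ℝ} (hq0 : ∀ x y, 0 ≤ q x y)
    (hμ0 : ∀ x, 0 ≤ μ x) (h : IsChainLaw μ q P) :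
    MarkovE (fun y z => ENNReal.ofReal (q y z)) P := by
  intro n X hX u
  rcases isEmpty_or_nonempty S with hS | ⟨⟨o⟩⟩
  · have : IsEmpty (ℕ → S) := ⟨fun f => hS.elim (f 0)⟩
    simp [Measure.eq_zero_of_isEmpty P]
  let R : (ℕ → S) → (Fin (n + 1) → S) := fun ω i => ω i
  have hR : Measurable R := by fun_prop
  let E : (Fin (n + 1) → S) → S → (ℕ → S) :=
    fun v z i => if h : i < n + 1 then v ⟨i, h⟩ else z
  have hXE : ∀ ω z, X ω = X (E (R ω) z) := by
    intro ω z
    refine hX _ _ fun i hi => ?_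
    have : i < n + 1 := by omega
    simp only [E, R, this, dif_pos]
  let T : (ℕ → S) → (Fin (n + 1) → S) × S := fun ω => (R ω, ω (n + 1))
  have hT : Measurable T := by fun_prop
  have e1 : ∫⁻ ω, X ω * u (ω (n + 1)) ∂P
      = ∑' p : (Fin (n + 1) → S) × S, X (E p.1 o) * u p.2 * P (T ⁻¹' {p}) := by
    have : ∀ ω, X ω * u (ω (n + 1)) =
        (fun p : (Fin (n + 1) → S) × S => X (E p.1 o) * u p.2) (T ω) := by
      intro ω; simp only [T, ← hXE]
    simp_rw [this]
    rw [← lintegral_map (f := fun p : (Fin (n + 1) → S) × S => X (E p.1 o) * u p.2)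
      (measurable_of_countable _) hT, lintegral_countable']
    refine tsum_congr fun p => ?_
    rw [Measure.map_apply hT (measurableSet_singleton _)]
  have e2 : ∀ u' : S → ℝ≥0∞, ∫⁻ ω, X ω * u' (ω n) ∂P
      = ∑' v : (Fin (n + 1) → S), X (E v o) * u' (v (Fin.last n)) * P (R ⁻¹' {v}) := by
    intro u'
    have : ∀ ω, X ω * u' (ω n) =
        (fun v : (Fin (n + 1) → S) => X (E v o) * u' (v (Fin.last n))) (R ω) := by
      intro ω; simp only [← hXE]; simp [R]
    simp_rw [this]
    rw [← lintegral_map (f := fun v : (Fin (n + 1) → S) => X (E v o) * u' (v (Fin.last n)))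
      (measurable_of_countable _) hR, lintegral_countable']
    refine tsum_congr fun p => ?_
    rw [Measure.map_apply hR (measurableSet_singleton _)]
  have e3 : ∀ v z, P (T ⁻¹' {(v, z)}) =
      P (R ⁻¹' {v}) * ENNReal.ofReal (q (v (Fin.last n)) z) := by
    intro v z
    have a1 : T ⁻¹' {(v, z)} = {ω | ∀ i ≤ n + 1, ω i = E v z i} := by
      ext ω
      simp only [T, R, Set.mem_preimage, Set.mem_singleton_iff, Prod.mk.injEq, funext_iff,
        Set.mem_ofPred_eq, E]
      constructor
      · rintro ⟨h1, h2⟩ i hi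
        rcases Nat.lt_or_ge i (n + 1) with h | h
        · simp [h, ← h1]
        · have : i = n + 1 := by omega
          subst this; simp [h2]
      · intro h
        refine ⟨fun i => ?_, ?_⟩
        · have := h i (by omega)
          rwa [dif_pos i.2] at this
        · simpa using h (n + 1) le_rfl
    have a2 : R ⁻¹' {v} = {ω | ∀ i ≤ n, ω i = E v z i} := by
      ext ω
      simp only [R, Set.mem_preimage, Set.mem_singleton_iff, funext_iff,
        Set.mem_ofPred_eq, E]
      constructor
      · intro h1 i hi
        have h : i < n + 1 := by omega
        simp [h, ← h1]
      · intro h i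
        have := h i (by omega)
        rwa [dif_pos i.2] at this
    rw [a1, a2, h, h, Finset.prod_range_succ, ← mul_assoc, ENNReal.ofReal_mul]
    · simp [E, Fin.last]
    · exact mul_nonneg (hμ0 _) (Finset.prod_nonneg fun i _ => hq0 _ _)
  rw [e1, e2, ENNReal.tsum_prod']
  refine tsum_congr fun v => ?_
  simp only [op, e3]
  rw [← ENNReal.tsum_mul_left, ← ENNReal.tsum_mul_right]
  refine tsum_congr fun z => ?_
  ring

lemma decomp {X : (ℕ → S) → ℝ≥0∞} (hX : Measurable X) (m : ℕ) (u : S → ℝ≥0∞) :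
    ∫⁻ ω, X ω * u (ω m) ∂P = ∑' w, (∫⁻ ω, X ω * ind w (ω m) ∂P) * u w := by
  have hi : ∀ w, Measurable fun ω : ℕ → S => ind w (ω m) := fun w =>
    (measurable_of_countable (ind w)).comp (measurable_pi_apply m)
  have h1 : ∀ w, (∫⁻ ω, X ω * ind w (ω m) ∂P) * u w = ∫⁻ ω, X ω * ind w (ω m) * u w ∂P :=
    fun w => (lintegral_mul_const _ (hX.mul (hi w))).symm
  simp only [h1]
  rw [← lintegral_tsum (f := fun w ω => X ω * ind w (ω m) * u w)
    (fun w => ((hX.mul (hi _)).mul_const _).aemeasurable)]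
  refine lintegral_congr fun ω => ?_
  simp only [mul_assoc]
  rw [ENNReal.tsum_mul_left, sum_ind]

lemma MarkovE.step (hM : MarkovE Q P) {n : ℕ} {X : (ℕ → S) → ℝ≥0∞} (hX : Adap n X) (z : S) :
    ∫⁻ ω, X ω * ind z (ω (n + 1)) ∂P = ∑' w, (∫⁻ ω, X ω * ind w (ω n) ∂P) * Q w z := by
  rw [hM n X hX, decomp hX.measurable]
  simp only [op_ind]

lemma MarkovE.flow (hM : MarkovE Q P) {N : ℕ} {X : (ℕ → S) → ℝ≥0∞} (hX : Adap N X) :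
    Flow Q (fun n z => ∫⁻ ω, X ω * ind z (ω (N + n)) ∂P) := by
  intro n z
  exact hM.step (hX.mono (Nat.le_add_right N n)) z

/-- pattern event -/
def nextD (C : Set S) (D : ℕ → Set (ℕ → S)) (n : ℕ) : Set (ℕ → S) :=
  {ω | ∃ i ≤ n, ω i ∈ C ∧ ω ∈ D i}

/-- adapted increasing events -/
structure Good (D : ℕ → Set (ℕ → S)) : Prop where
  adap : ∀ n, Adap n (fun ω => ω ∈ D n)
  mono : Monotone D

lemma Good.ind {D : ℕ → Set (ℕ → S)} (h : Good D) (n : ℕ) :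
    Adap n ((D n).indicator (1 : (ℕ → S) → ℝ≥0∞)) := by
  intro ω ω' hh
  have := h.adap n ω ω' hh
  simp only [eq_iff_iff] at this
  by_cases h1 : ω' ∈ D n
  · simp [h1, this.2 h1]
  · have h2 : ω ∉ D n := fun h => h1 (this.1 h)
    simp [h1, h2]

lemma Good.meas {D : ℕ → Set (ℕ → S)} (h : Good D) (n : ℕ) : MeasurableSet (D n) :=
  (measurable_indicator_const_iff (1 : ℝ≥0∞)).1 (h.ind n).measurable

lemma Good.next {D : ℕ → Set (ℕ → S)} (h : Good D) (C : Set S) : Good (nextD C D) := by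
  refine ⟨fun n ω ω' hh => ?_, fun n m hnm ω => ?_⟩
  · have : ∀ i ≤ n, (ω ∈ D i) = (ω' ∈ D i) := fun i hi =>
      h.adap i ω ω' fun j hj => hh j (hj.trans hi)
    simp only [nextD, Set.mem_ofPred_eq, eq_iff_iff]
    refine exists_congr fun i => and_congr_right fun hi => ?_
    rw [hh i hi, this i hi]
  · rintro ⟨i, hi, h⟩
    exact ⟨i, hi.trans hnm, h⟩

lemma next_bound (hM : MarkovE Q P) {D : ℕ → Set (ℕ → S)} (h : Good D) (C : Set S)
    (u : S → ℝ≥0∞) (hu : ∀ z, ∑' w, u w * Q w z ≤ u z)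
    (hD : ∀ z ∈ C, ∑' n, ∫⁻ ω, (D n).indicator 1 ω * ind z (ω n) ∂P ≤ u z) (z : S) :
    ∑' n, ∫⁻ ω, (nextD C D n).indicator 1 ω * ind z (ω n) ∂P ≤ u z := by
  rw [ENNReal.tsum_eq_iSup_nat]
  refine iSup_le fun N => ?_
  induction N generalizing z with
  | zero => simp
  | succ N ih =>
    by_cases hz : z ∈ C
    · refine le_trans ?_ (hD z hz)
      refine le_trans (Finset.sum_le_sum fun n _ => ?_) (ENNReal.sum_le_tsum _)
      refine lintegral_mono fun ω => ?_
      gcongr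
      rintro ω ⟨i, hi, _, h2⟩
      exact h.mono hi h2
    · rw [Finset.sum_range_succ']
      have h0 : ∫⁻ ω, (nextD C D 0).indicator 1 ω * ind z (ω 0) ∂P = 0 := by
        rw [← lintegral_zero (μ := P)]
        refine lintegral_congr fun ω => ?_
        by_cases h1 : ω 0 = z
        · have : ω ∉ nextD C D 0 := by
            rintro ⟨i, hi, h2, _⟩
            have : i = 0 := by omega
            subst this
            exact hz (h1 ▸ h2)
          simp [this]
        · simp [ind, h1]
      have h1 : ∀ n, ∫⁻ ω, (nextD C D (n + 1)).indicator 1 ω * ind z (ω (n + 1)) ∂P ≤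
          ∑' w, (∫⁻ ω, (nextD C D n).indicator 1 ω * ind w (ω n) ∂P) * Q w z := by
        intro n
        rw [← hM.step ((h.next C).ind n)]
        refine lintegral_mono fun ω => ?_
        by_cases h1 : ω (n + 1) = z
        · refine mul_le_mul_left ?_ _
          by_cases h2 : ω ∈ nextD C D (n + 1)
          · have : ω ∈ nextD C D n := by
              obtain ⟨i, hi, h3, h4⟩ := h2
              refine ⟨i, ?_, h3, h4⟩
              by_contra hcon
              have : i = n + 1 := by omega
              subst this
              exact hz (h1 ▸ h3)
            simp [this, h2]
          · simp [h2]
        · simp [ind, h1]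
      rw [h0, add_zero]
      refine (Finset.sum_le_sum fun n _ => h1 n).trans ?_
      rw [← Summable.tsum_finsetSum (fun _ _ => ENNReal.summable)]
      refine le_trans (ENNReal.tsum_le_tsum fun w => ?_) (hu z)
      rw [← Finset.sum_mul]
      gcongr
      exact ih w

lemma meas_coord (u : S → ℝ≥0∞) (m : ℕ) : Measurable fun ω : ℕ → S => u (ω m) :=
  (measurable_of_countable u).comp (measurable_pi_apply m)

lemma meas_mul {X : (ℕ → S) → ℝ≥0∞} (hX : Measurable X) (u : S → ℝ≥0∞) (m : ℕ) :
    Measurable fun ω : ℕ → S => X ω * u (ω m) := hX.mul (meas_coord u m)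

lemma adap_coord (u : S → ℝ≥0∞) (m : ℕ) : Adap m fun ω : ℕ → S => u (ω m) :=
  fun _ _ h => congrArg u (h m le_rfl)

lemma decomp' (m : ℕ) (u : S → ℝ≥0∞) :
    ∫⁻ ω, u (ω m) ∂P = ∑' w, (∫⁻ ω, ind w (ω m) ∂P) * u w := by
  have := decomp (P := P) (X := fun _ => 1) measurable_const m u
  simpa using this

lemma MarkovE.flow0 (hM : MarkovE Q P) : Flow Q (fun n z => ∫⁻ ω, ind z (ω n) ∂P) := by
  have := hM.flow (N := 0) (X := fun _ => 1) (fun _ _ _ => rfl)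
  simpa using this

variable [IsProbabilityMeasure P]

lemma sum_c_eq (hM : MarkovE Q P) (hQ : ∀ y, ∑' z, Q y z = 1)
    (hfin : ∀ z, ∑' n, ∫⁻ ω, ind z (ω n) ∂P ≠ ∞) (K : Finset S) :
    ∑' n, ∫⁻ ω, cK Q K (ω n) ∂P ≤ 1 := by
  have := hM.flow0.telescope hQ hfin K
  simp only [← decomp'] at this
  rw [this]
  calc ∫⁻ ω, hK Q K (ω 0) ∂P ≤ ∫⁻ ω, 1 ∂P := lintegral_mono fun ω => hK_le_one _ _
    _ = 1 := by simp

lemma pot_prob (hM : MarkovE Q P) (hQ : ∀ y, ∑' z, Q y z = 1)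
    (hfin : ∀ z, ∑' n, ∫⁻ ω, ind z (ω n) ∂P ≠ ∞) {D : ℕ → Set (ℕ → S)} (h : Good D)
    (α : ℝ≥0∞) (hD : ∀ z, ∑' n, ∫⁻ ω, (D n).indicator 1 ω * ind z (ω n) ∂P ≤
      α * ∑' n, ∫⁻ ω, ind z (ω n) ∂P) (N : ℕ) : P (D N) ≤ α := by
  have key : ∀ K : Finset S,
      ∑' w, (∫⁻ ω, (D N).indicator 1 ω * ind w (ω N) ∂P) * hK Q K w ≤ α := by
    intro K
    have hfl := hM.flow (h.ind N)
    have hle : ∀ n ω, (D N).indicator (1 : (ℕ → S) → ℝ≥0∞) ω ≤ (D (N + n)).indicator 1 ω := by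
      intro n ω
      exact Set.indicator_le_indicator_of_subset (h.mono (Nat.le_add_right N n))
        (fun _ => zero_le_one) ω
    have hfin' : ∀ z, ∑' n, ∫⁻ ω, (D N).indicator 1 ω * ind z (ω (N + n)) ∂P ≠ ∞ := by
      intro z
      refine ne_top_of_le_ne_top (hfin z) ?_
      refine le_trans ?_ (ENNReal.tsum_comp_le_tsum_of_injective (add_right_injective N) _)
      refine ENNReal.tsum_le_tsum fun n => lintegral_mono fun ω => ?_
      by_cases h1 : ω ∈ D N <;> simp [h1]
    have ht := hfl.telescope hQ hfin' K
    simp only [add_zero] at ht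
    rw [← ht]
    calc ∑' n, ∑' w, (∫⁻ ω, (D N).indicator 1 ω * ind w (ω (N + n)) ∂P) * cK Q K w
        ≤ ∑' n, ∑' w, (∫⁻ ω, (D (N + n)).indicator 1 ω * ind w (ω (N + n)) ∂P) * cK Q K w := by
          refine ENNReal.tsum_le_tsum fun n => ENNReal.tsum_le_tsum fun w => ?_
          refine mul_le_mul_left (lintegral_mono fun ω => ?_) _
          exact mul_le_mul_left (hle n ω) _
      _ ≤ ∑' n, ∑' w, (∫⁻ ω, (D n).indicator 1 ω * ind w (ω n) ∂P) * cK Q K w :=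
          ENNReal.tsum_comp_le_tsum_of_injective (add_right_injective N)
            (fun n => ∑' w, (∫⁻ ω, (D n).indicator 1 ω * ind w (ω n) ∂P) * cK Q K w)
      _ = ∑' w, (∑' n, ∫⁻ ω, (D n).indicator 1 ω * ind w (ω n) ∂P) * cK Q K w := by
          rw [ENNReal.tsum_comm]
          simp only [ENNReal.tsum_mul_right]
      _ ≤ ∑' w, α * (∑' n, ∫⁻ ω, ind w (ω n) ∂P) * cK Q K w :=
          ENNReal.tsum_le_tsum fun w => mul_le_mul_left (hD w) _
      _ = α * ∑' n, ∫⁻ ω, cK Q K (ω n) ∂P := by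
          simp only [decomp' (P := P) _ (cK Q K)]
          rw [ENNReal.tsum_comm, ← ENNReal.tsum_mul_left]
          simp only [ENNReal.tsum_mul_right, mul_assoc]
      _ ≤ α := mul_le_of_le_one_right' (sum_c_eq hM hQ hfin K)
  have h1 : P (D N) = ∑' w, ∫⁻ ω, (D N).indicator 1 ω * ind w (ω N) ∂P := by
    have := decomp (P := P) (h.ind N).measurable N (fun _ => 1)
    simp only [mul_one] at this
    rw [← this, lintegral_indicator_one (h.meas N)]
  rw [h1]
  refine ENNReal.summable.tsum_le_of_sum_le fun K => ?_
  refine le_trans ?_ (key K)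
  refine le_trans (Finset.sum_le_sum fun w hw => ?_) (ENNReal.sum_le_tsum K)
  simp [hK_eq_one K w hw]

/-- alternating pattern -/
def DD (A B : Set S) : ℕ → ℕ → Set (ℕ → S)
  | 0 => fun _ => Set.univ
  | k + 1 => nextD A (nextD B (DD A B k))

lemma DD_good (A B : Set S) (k : ℕ) : Good (DD A B k) := by
  induction k with
  | zero => exact ⟨fun _ _ _ _ => rfl, fun _ _ _ => le_rfl⟩
  | succ k ih => exact (ih.next B).next A

lemma DD_freq (A B : Set S) (k : ℕ) (ω : ℕ → S) (hA : ∃ᶠ n in atTop, ω n ∈ A)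
    (hB : ∃ᶠ n in atTop, ω n ∈ B) : ∃ n, ω ∈ DD A B k n := by
  induction k with
  | zero => exact ⟨0, trivial⟩
  | succ k ih =>
    obtain ⟨n, hn⟩ := ih
    obtain ⟨m, hm, hmB⟩ := frequently_atTop.1 hB n
    obtain ⟨j, hj, hjA⟩ := frequently_atTop.1 hA m
    exact ⟨j, j, le_rfl, hjA, m, hj, hmB, (DD_good A B k).mono hm hn⟩

lemma crossing (hM : MarkovE Q P) (hQ : ∀ y, ∑' z, Q y z = 1)
    (hfin : ∀ z, ∑' n, ∫⁻ ω, ind z (ω n) ∂P ≠ ∞)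
    (hpos : ∀ z, ∑' n, ∫⁻ ω, ind z (ω n) ∂P ≠ 0)
    (g : S → ℝ≥0∞) (hg : ∀ z, ∑' w, g w * Q w z ≤ g z)
    (a b : ℝ≥0∞) (hab : a < b) :
    ∀ᵐ ω ∂P, ¬ ((∃ᶠ n in atTop, g (ω n) / ∑' m, ∫⁻ ω', ind (ω n) (ω' m) ∂P < a) ∧
      ∃ᶠ n in atTop, b < g (ω n) / ∑' m, ∫⁻ ω', ind (ω n) (ω' m) ∂P) := by
  rcases eq_or_ne b ∞ with hb | hb
  · simp [hb]
  have hb0 : b ≠ 0 := (zero_le.trans_lt hab).ne'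
  set Gm : S → ℝ≥0∞ := fun z => ∑' n, ∫⁻ ω, ind z (ω n) ∂P with hGm
  have hGe : ∀ z, ∑' w, Gm w * Q w z ≤ Gm z := by
    intro z
    have := hM.flow0.sum_eq z
    simp only [hGm]
    rw [this]
    exact le_add_self
  set A : Set S := {z | g z / Gm z < a}
  set B : Set S := {z | b < g z / Gm z}
  set ρ := a * b⁻¹ with hρ
  have hexc : ∀ (t : ℝ≥0∞) (u : S → ℝ≥0∞), (∀ z, ∑' w, u w * Q w z ≤ u z) →
      ∀ z, ∑' w, (t * u w) * Q w z ≤ t * u z := by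
    intro t u hu z
    simp only [mul_assoc, ENNReal.tsum_mul_left]
    exact mul_le_mul_right (hu z) _
  have hbd : ∀ k z, ∑' n, ∫⁻ ω, (DD A B k n).indicator 1 ω * ind z (ω n) ∂P ≤ ρ ^ k * Gm z := by
    intro k
    induction k with
    | zero => intro z; simp [DD, hGm]
    | succ k ih =>
      have s1 : ∀ z, ∑' n, ∫⁻ ω, (nextD B (DD A B k) n).indicator 1 ω * ind z (ω n) ∂P ≤
          (ρ ^ k * b⁻¹) * g z := by
        refine next_bound hM (DD_good A B k) B (fun z => (ρ ^ k * b⁻¹) * g z)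
          (hexc _ g hg) fun z hz => (ih z).trans ?_
        rw [mul_assoc]
        refine mul_le_mul_right ?_ _
        have : b * Gm z ≤ g z := (ENNReal.le_div_iff_mul_le (Or.inl (hpos z))
          (Or.inl (hfin z))).1 (le_of_lt hz)
        calc Gm z = b⁻¹ * (b * Gm z) := by
              rw [← mul_assoc, ENNReal.inv_mul_cancel hb0 hb, one_mul]
          _ ≤ _ := mul_le_mul_right this _
      refine next_bound hM ((DD_good A B k).next B) A (fun z => ρ ^ (k + 1) * Gm z)
          (hexc _ Gm hGe) fun z hz => (s1 z).trans ?_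
      have : g z ≤ a * Gm z := (ENNReal.div_le_iff_le_mul (Or.inl (hpos z))
          (Or.inl (hfin z))).1 (le_of_lt hz)
      calc ρ ^ k * b⁻¹ * g z ≤ ρ ^ k * b⁻¹ * (a * Gm z) := mul_le_mul_right this _
        _ = _ := by rw [pow_succ, hρ]; ring
  have hP : ∀ k, P (⋃ n, DD A B k n) ≤ ρ ^ k := by
    intro k
    rw [(DD_good A B k).mono.measure_iUnion]
    exact iSup_le fun N => pot_prob hM hQ hfin (DD_good A B k) _ (hbd k) N
  have hρ1 : ρ < 1 := by
    rw [hρ, ← div_eq_mul_inv]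
    exact ENNReal.div_lt_of_lt_mul (by simpa using hab)
  rw [ae_iff]
  refine le_antisymm ?_ zero_le
  refine ge_of_tendsto' (ENNReal.tendsto_pow_atTop_nhds_zero_of_lt_one hρ1) fun k => ?_
  refine le_trans (measure_mono ?_) (hP k)
  intro ω hω
  simp only [Set.mem_ofPred_eq, not_not] at hω
  exact Set.mem_iUnion.2 (DD_freq A B k ω hω.1 hω.2)

lemma ae_conv (hM : MarkovE Q P) (hQ : ∀ y, ∑' z, Q y z = 1)
    (hfin : ∀ z, ∑' n, ∫⁻ ω, ind z (ω n) ∂P ≠ ∞)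
    (hpos : ∀ z, ∑' n, ∫⁻ ω, ind z (ω n) ∂P ≠ 0)
    (g : S → ℝ≥0∞) (hg : ∀ z, ∑' w, g w * Q w z ≤ g z) :
    ∀ᵐ ω ∂P, ∃ l, Tendsto (fun n => g (ω n) / ∑' m, ∫⁻ ω', ind (ω n) (ω' m) ∂P)
      atTop (𝓝 l) := by
  obtain ⟨s, hsc, hsd⟩ := TopologicalSpace.exists_countable_dense ℝ≥0∞
  have : ∀ᵐ ω ∂P, ∀ a ∈ s, ∀ b ∈ s, a < b →
      ¬ ((∃ᶠ n in atTop, g (ω n) / ∑' m, ∫⁻ ω', ind (ω n) (ω' m) ∂P < a) ∧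
      ∃ᶠ n in atTop, b < g (ω n) / ∑' m, ∫⁻ ω', ind (ω n) (ω' m) ∂P) := by
    rw [ae_ball_iff hsc]
    intro a _
    rw [ae_ball_iff hsc]
    intro b _
    rw [eventually_imp_distrib_left]
    exact crossing hM hQ hfin hpos g hg a b
  filter_upwards [this] with ω hω
  exact tendsto_of_no_upcrossings hsd hω

lemma adaptive_sum (hM : MarkovE Q P) (hQ : ∀ y, ∑' z, Q y z = 1)
    {D : ℕ → Set (ℕ → S)} (h : Good D) (K : Finset S) :
    ∑' n, ∫⁻ ω, (D n).indicator 1 ω * cK Q K (ω n) ∂P ≤ P (⋃ n, D n) := by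
  have key : ∀ R : ℕ, ∑ n ∈ Finset.range R, ∫⁻ ω, (D n).indicator 1 ω * cK Q K (ω n) ∂P +
      ∫⁻ ω, (D R).indicator 1 ω * hK Q K (ω R) ∂P ≤ P (D R) := by
    have hle : ∀ (E : Set (ℕ → S)) (m : ℕ), MeasurableSet E →
        ∫⁻ ω, E.indicator 1 ω * hK Q K (ω m) ∂P ≤ P E := by
      intro E m hE
      rw [← lintegral_indicator_one hE]
      exact lintegral_mono fun ω => mul_le_of_le_one_right' (hK_le_one _ _)
    intro R
    induction R with
    | zero => simpa using hle (D 0) 0 (h.meas 0)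
    | succ R ih =>
      have e1 : ∫⁻ ω, (D (R + 1)).indicator 1 ω * hK Q K (ω (R + 1)) ∂P =
          ∫⁻ ω, (D R).indicator 1 ω * hK Q K (ω (R + 1)) ∂P +
          ∫⁻ ω, (D (R + 1) \ D R).indicator 1 ω * hK Q K (ω (R + 1)) ∂P := by
        rw [← lintegral_add_left (meas_mul (h.ind R).measurable _ _)]
        refine lintegral_congr fun ω => ?_
        by_cases h1 : ω ∈ D R
        · have h2 := h.mono (Nat.le_succ R) h1
          simp [h1, h2]
        · simp [h1, Set.indicator]
      have e2 : ∫⁻ ω, (D R).indicator 1 ω * cK Q K (ω R) ∂P +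
          ∫⁻ ω, (D R).indicator 1 ω * hK Q K (ω (R + 1)) ∂P =
          ∫⁻ ω, (D R).indicator 1 ω * hK Q K (ω R) ∂P := by
        rw [hM R _ (h.ind R), ← lintegral_add_left (meas_mul (h.ind R).measurable _ _)]
        refine lintegral_congr fun ω => ?_
        rw [← mul_add, cK_add hQ]
      rw [Finset.sum_range_succ, e1, add_assoc, ← add_assoc (∫⁻ ω, _ * cK Q K (ω R) ∂P), e2,
        ← add_assoc]
      refine (add_le_add ih (hle _ (R + 1) ((h.meas (R + 1)).diff (h.meas R)))).trans ?_
      rw [← measure_union Set.disjoint_sdiff_right ((h.meas (R + 1)).diff (h.meas R)),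
        Set.union_sdiff_cancel (h.mono (Nat.le_succ R))]
  rw [ENNReal.tsum_eq_iSup_nat]
  refine iSup_le fun R => ?_
  exact le_self_add.trans ((key R).trans (measure_mono (Set.subset_iUnion _ _)))

/-- oscillation events -/
def osc (f : S → ℝ≥0∞) (ε : ℝ≥0∞) (N n : ℕ) : Set (ℕ → S) :=
  {ω | ∃ i ≤ n, N ≤ i ∧ ¬ (f (ω i) ≤ f (ω N) + ε ∧ f (ω N) ≤ f (ω i) + ε)}

lemma osc_good (f : S → ℝ≥0∞) (ε : ℝ≥0∞) (N : ℕ) : Good (osc f ε N) := by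
  refine ⟨fun n ω ω' hh => ?_, fun n m hnm ω => ?_⟩
  · simp only [osc, Set.mem_ofPred_eq, eq_iff_iff]
    refine exists_congr fun i => and_congr_right fun hi => and_congr_right fun hN => ?_
    rw [hh i hi, hh N (hN.trans hi)]
  · rintro ⟨i, hi, h⟩
    exact ⟨i, hi.trans hnm, h⟩

lemma osc_tendsto (f : S → ℝ≥0∞) {ε C : ℝ≥0∞} (hε : 0 < ε) (hC : C ≠ ∞) (hf : ∀ z, f z ≤ C)
    (hconv : ∀ᵐ ω ∂P, ∃ l, Tendsto (fun n => f (ω n)) atTop (𝓝 l)) :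
    Tendsto (fun N => P (⋃ n, osc f ε N n)) atTop (𝓝 0) := by
  rw [← measure_empty (μ := P)]
  refine tendsto_measure_of_ae_tendsto_indicator_of_isFiniteMeasure atTop MeasurableSet.empty
    (fun N => MeasurableSet.iUnion fun n => (osc_good f ε N).meas n) ?_
  filter_upwards [hconv] with ω ⟨l, hl⟩
  have hl' : l ≠ ∞ := ne_top_of_le_ne_top hC (le_of_tendsto' hl fun n => hf _)
  have := (ENNReal.tendsto_nhds hl').1 hl (ε / 2) (ENNReal.half_pos hε.ne')
  obtain ⟨N0, hN0⟩ := eventually_atTop.1 this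
  filter_upwards [eventually_ge_atTop N0] with N hN
  simp only [Set.mem_iUnion, osc, Set.mem_ofPred_eq, Set.mem_empty_iff_false, iff_false]
  rintro ⟨n, i, hi, hNi, hcon⟩
  apply hcon
  have aux : ∀ p r, N0 ≤ p → N0 ≤ r → f (ω p) ≤ f (ω r) + ε := by
    intro p r hp hr
    have h1 := (hN0 p hp).2
    have h2 := tsub_le_iff_right.1 (hN0 r hr).1
    calc f (ω p) ≤ l + ε / 2 := h1
      _ ≤ f (ω r) + ε / 2 + ε / 2 := add_le_add h2 le_rfl
      _ = _ := by rw [add_assoc, ENNReal.add_halves]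
  exact ⟨aux _ _ (hN.trans hNi) hN, aux _ _ hN (hN.trans hNi)⟩

lemma mean_bounds (hM : MarkovE Q P) (hQ : ∀ y, ∑' z, Q y z = 1)
    (hfin : ∀ z, ∑' n, ∫⁻ ω, ind z (ω n) ∂P ≠ ∞)
    {l : ℕ → S → ℝ≥0∞} (hl : Flow Q l) {x : S} (h0 : ∀ z, l 0 z = ind x z)
    (hlfin : ∀ z, ∑' n, l n z ≠ ∞) (f : S → ℝ≥0∞) {C : ℝ≥0∞} (hC : C ≠ ∞) (hf : ∀ z, f z ≤ C)
    (hfG : ∀ z, (∑' n, ∫⁻ ω, ind z (ω n) ∂P) * f z = ∑' n, l n z) (ε : ℝ≥0∞) (N : ℕ) :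
    ∫⁻ ω, f (ω N) ∂P ≤ 1 + (ε + C * P (⋃ n, osc f ε N n)) ∧
    1 ≤ ∫⁻ ω, f (ω N) ∂P + (ε + C * P (⋃ n, osc f ε N n)) := by
  set δ := P (⋃ n, osc f ε N n) with hδ
  -- identity (ii)
  have e2 : ∀ K : Finset S, x ∈ K → ∑' n, ∫⁻ ω, f (ω n) * cK Q K (ω n) ∂P = 1 := by
    intro K hx
    have ht := hl.telescope hQ hlfin K
    have hr : ∑' w, l 0 w * hK Q K w = 1 := by
      simp only [h0]
      rw [tsum_eq_single x]
      · simp [ind, hK_eq_one K x hx]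
      · intro b hb; simp [ind, hb]
    rw [hr, ENNReal.tsum_comm] at ht
    rw [← ht]
    simp only [decomp' (P := P) _ (fun w => f w * cK Q K w)]
    rw [ENNReal.tsum_comm]
    refine tsum_congr fun w => ?_
    rw [ENNReal.tsum_mul_right, ENNReal.tsum_mul_right, ← mul_assoc, hfG]
  -- identity (i)
  have e1 : ∀ K : Finset S, ∑' n, ∫⁻ ω, f (ω N) * cK Q K (ω (N + n)) ∂P =
      ∫⁻ ω, f (ω N) * hK Q K (ω N) ∂P := by
    intro K
    have hfin' : ∀ z, ∑' n, ∫⁻ ω, f (ω N) * ind z (ω (N + n)) ∂P ≠ ∞ := by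
      intro z
      refine ne_top_of_le_ne_top (ENNReal.mul_ne_top hC (hfin z)) ?_
      rw [← ENNReal.tsum_mul_left]
      refine le_trans ?_ (ENNReal.tsum_comp_le_tsum_of_injective (add_right_injective N) _)
      refine ENNReal.tsum_le_tsum fun n => ?_
      rw [← lintegral_const_mul _ (meas_coord _ _)]
      exact lintegral_mono fun ω => mul_le_mul_left (hf _) _
    have ht := (hM.flow (adap_coord f N)).telescope hQ hfin' K
    simp only [← decomp (P := P) (meas_coord f N), add_zero] at ht
    exact ht
  have hsumc : ∀ K : Finset S, ∑' n, ∫⁻ ω, cK Q K (ω (N + n)) ∂P ≤ 1 := fun K =>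
    (ENNReal.tsum_comp_le_tsum_of_injective (add_right_injective N)
      (fun n => ∫⁻ ω, cK Q K (ω n) ∂P)).trans (sum_c_eq hM hQ hfin K)
  have hsumD : ∀ K : Finset S,
      ∑' n, ∫⁻ ω, (osc f ε N (N + n)).indicator 1 ω * cK Q K (ω (N + n)) ∂P ≤ δ := fun K =>
    (ENNReal.tsum_comp_le_tsum_of_injective (add_right_injective N)
      (fun n => ∫⁻ ω, (osc f ε N n).indicator 1 ω * cK Q K (ω n) ∂P)).trans
      (adaptive_sum hM hQ (osc_good f ε N) K)
  -- comparison
  have cmp : ∀ (K : Finset S) (φ ψ : ℕ → (ℕ → S) → ℝ≥0∞), (∀ n, Measurable (ψ n)) →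
      (∀ n ω, φ n ω ≤ C) →
      (∀ n ω, ω ∉ osc f ε N (N + n) → φ n ω ≤ ψ n ω + ε) →
      ∑' n, ∫⁻ ω, φ n ω * cK Q K (ω (N + n)) ∂P ≤
        ∑' n, ∫⁻ ω, ψ n ω * cK Q K (ω (N + n)) ∂P + (ε + C * δ) := by
    intro K φ ψ hψ hφ hcl
    have : ∀ n, ∫⁻ ω, φ n ω * cK Q K (ω (N + n)) ∂P ≤
        ∫⁻ ω, ψ n ω * cK Q K (ω (N + n)) ∂P + (ε * ∫⁻ ω, cK Q K (ω (N + n)) ∂P +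
        C * ∫⁻ ω, (osc f ε N (N + n)).indicator 1 ω * cK Q K (ω (N + n)) ∂P) := by
      intro n
      have m1 := meas_coord (cK Q K) (N + n)
      have m2 := ((osc_good f ε N).ind (N + n)).measurable
      rw [← lintegral_const_mul _ m1, ← lintegral_const_mul _ (meas_mul m2 _ _),
        ← lintegral_add_left (m1.const_mul _), ← lintegral_add_left (meas_mul (hψ n) _ _)]
      refine lintegral_mono fun ω => ?_
      rw [← mul_assoc, ← add_mul, ← add_mul]
      refine mul_le_mul_left ?_ _
      by_cases h1 : ω ∈ osc f ε N (N + n)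
      · simp only [h1, Set.indicator_of_mem, Pi.one_apply, mul_one]
        exact (hφ n ω).trans (le_add_self.trans le_add_self)
      · simp only [h1, not_false_eq_true, Set.indicator_of_notMem, mul_zero, add_zero]
        exact hcl n ω h1
    refine (ENNReal.tsum_le_tsum this).trans ?_
    rw [ENNReal.tsum_add, ENNReal.tsum_add, ENNReal.tsum_mul_left, ENNReal.tsum_mul_left]
    gcongr
    · exact mul_le_of_le_one_right' (hsumc K)
    · exact hsumD K
  have hno : ∀ n ω, ω ∉ osc f ε N (N + n) →
      f (ω (N + n)) ≤ f (ω N) + ε ∧ f (ω N) ≤ f (ω (N + n)) + ε := by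
    intro n ω h1
    by_contra hcon
    exact h1 ⟨N + n, le_rfl, Nat.le_add_right _ _, hcon⟩
  constructor
  · have hK' : ∀ K : Finset S, x ∈ K →
        ∫⁻ ω, f (ω N) * hK Q K (ω N) ∂P ≤ 1 + (ε + C * δ) := by
      intro K hx
      rw [← e1 K]
      refine (cmp K (fun n ω => f (ω N)) (fun n ω => f (ω (N + n))) (fun n => meas_coord _ _)
        (fun n ω => hf _) (fun n ω h1 => (hno n ω h1).2)).trans ?_
      gcongr
      rw [← e2 K hx]
      exact ENNReal.tsum_comp_le_tsum_of_injective (add_right_injective N)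
        (fun n => ∫⁻ ω, f (ω n) * cK Q K (ω n) ∂P)
    rw [decomp']
    refine ENNReal.summable.tsum_le_of_sum_le fun K => ?_
    refine le_trans ?_ (hK' (insert x K) (Finset.mem_insert_self _ _))
    rw [decomp' (P := P) N (fun w => f w * hK Q (insert x K) w)]
    refine le_trans (Finset.sum_le_sum fun w hw => ?_) (ENNReal.sum_le_tsum K)
    rw [hK_eq_one _ w (Finset.mem_insert_of_mem hw), mul_one]
  · have hK' : ∀ K : Finset S, x ∈ K →
        1 ≤ C * (1 - ∑ w ∈ K, ∫⁻ ω, ind w (ω N) ∂P) + (∫⁻ ω, f (ω N) ∂P + (ε + C * δ)) := by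
      intro K hx
      refine (e2 K hx).symm.le.trans ?_
      rw [← ENNReal.summable.sum_add_tsum_nat_add' (k := N)]
      refine add_le_add ?_ ?_
      · have hs : ∑ n ∈ Finset.range N, ∫⁻ ω, cK Q K (ω n) ∂P ≤
            1 - ∑ w ∈ K, ∫⁻ ω, ind w (ω N) ∂P := by
          have htel : ∀ R : ℕ, ∑ n ∈ Finset.range R, ∫⁻ ω, cK Q K (ω n) ∂P +
              ∫⁻ ω, hK Q K (ω R) ∂P = ∫⁻ ω, hK Q K (ω 0) ∂P := by
            intro R
            induction R with
            | zero => simp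
            | succ R ih =>
              have := hM R (fun _ => 1) (fun _ _ _ => rfl) (hK Q K)
              simp only [one_mul] at this
              rw [← ih, Finset.sum_range_succ, add_assoc, this,
                ← lintegral_add_left (meas_coord _ _)]
              simp only [cK_add hQ]
          have hle1 : ∫⁻ ω, hK Q K (ω 0) ∂P ≤ 1 := by
            calc ∫⁻ ω, hK Q K (ω 0) ∂P ≤ ∫⁻ ω, 1 ∂P := lintegral_mono fun ω => hK_le_one _ _
              _ = 1 := by simp
          have hle2 : ∑ w ∈ K, ∫⁻ ω, ind w (ω N) ∂P ≤ ∫⁻ ω, hK Q K (ω N) ∂P := by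
            rw [decomp' N (hK Q K)]
            refine le_trans (Finset.sum_le_sum fun w hw => ?_) (ENNReal.sum_le_tsum K)
            rw [hK_eq_one _ w hw, mul_one]
          have hne : ∑ w ∈ K, ∫⁻ ω, ind w (ω N) ∂P ≠ ∞ := by
            refine ne_top_of_le_ne_top ENNReal.one_ne_top (hle2.trans ?_)
            exact (le_add_self.trans (htel N).le).trans hle1
          refine ENNReal.le_sub_of_add_le_right hne ?_
          exact (add_le_add le_rfl hle2).trans ((htel N).le.trans hle1)
        refine le_trans ?_ (mul_le_mul_right hs C)
        rw [Finset.mul_sum]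
        refine Finset.sum_le_sum fun n _ => ?_
        rw [← lintegral_const_mul _ (meas_coord _ _)]
        exact lintegral_mono fun ω => mul_le_mul_left (hf _) _
      · simp only [add_comm _ N]
        refine (cmp K (fun n ω => f (ω (N + n))) (fun n ω => f (ω N)) (fun n => meas_coord _ _)
          (fun n ω => hf _) (fun n ω h1 => (hno n ω h1).1)).trans ?_
        gcongr
        rw [e1 K]
        exact lintegral_mono fun ω => mul_le_of_le_one_right' (hK_le_one _ _)
    have hp : ∑' w, ∫⁻ ω, ind w (ω N) ∂P = 1 := by
      have := decomp' (P := P) N (fun _ => 1)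
      simpa using this.symm
    have hlim : Tendsto (fun K : Finset S => C * (1 - ∑ w ∈ K, ∫⁻ ω, ind w (ω N) ∂P) +
        (∫⁻ ω, f (ω N) ∂P + (ε + C * δ))) atTop
        (𝓝 (C * (1 - 1) + (∫⁻ ω, f (ω N) ∂P + (ε + C * δ)))) := by
      refine Tendsto.add ?_ tendsto_const_nhds
      refine ENNReal.Tendsto.const_mul ?_ (Or.inr hC)
      refine ENNReal.Tendsto.sub tendsto_const_nhds ?_ (Or.inl ENNReal.one_ne_top)
      have := (ENNReal.summable (f := fun w => ∫⁻ ω, ind w (ω N) ∂P)).hasSum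
      rwa [hp] at this
    rw [tsub_self, mul_zero, zero_add] at hlim
    refine ge_of_tendsto hlim ?_
    filter_upwards [eventually_ge_atTop {x}] with K hx
    exact hK' K (hx (Finset.mem_singleton_self x))

lemma mean_tendsto (hM : MarkovE Q P) (hQ : ∀ y, ∑' z, Q y z = 1)
    (hfin : ∀ z, ∑' n, ∫⁻ ω, ind z (ω n) ∂P ≠ ∞)
    {l : ℕ → S → ℝ≥0∞} (hl : Flow Q l) {x : S} (h0 : ∀ z, l 0 z = ind x z)
    (hlfin : ∀ z, ∑' n, l n z ≠ ∞) (f : S → ℝ≥0∞) {C : ℝ≥0∞} (hC : C ≠ ∞) (hf : ∀ z, f z ≤ C)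
    (hfG : ∀ z, (∑' n, ∫⁻ ω, ind z (ω n) ∂P) * f z = ∑' n, l n z)
    (hconv : ∀ᵐ ω ∂P, ∃ l, Tendsto (fun n => f (ω n)) atTop (𝓝 l)) :
    Tendsto (fun N => ∫⁻ ω, f (ω N) ∂P) atTop (𝓝 1) := by
  rw [ENNReal.tendsto_nhds ENNReal.one_ne_top]
  intro ε hε
  have hε2 : 0 < ε / 2 := ENNReal.half_pos hε.ne'
  have ht := ENNReal.Tendsto.const_mul (osc_tendsto (P := P) f hε2 hC hf hconv) (Or.inr hC)
  rw [mul_zero] at ht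
  filter_upwards [ht.eventually_le_const hε2] with N hN
  obtain ⟨h1, h2⟩ := mean_bounds hM hQ hfin hl h0 hlfin f hC hf hfG (ε / 2) N
  have h3 : ε / 2 + C * P (⋃ n, osc f (ε / 2) N n) ≤ ε :=
    (add_le_add le_rfl hN).trans (ENNReal.add_halves ε).le
  refine ⟨tsub_le_iff_right.2 (h2.trans ?_), h1.trans ?_⟩
  · gcongr
  · gcongr

end markov

end DH

/-- Doob–Hunt convergence: for a transient Markov chain started from `μ`
with `G(μ,y) > 0` for all `y`, and any state `x`, the Martin kernel sequence
`M(x, Y_n) = G(x,Y_n)/G(μ,Y_n)` converges almost surely, and `E[M(x,Y_n)] → 1`. -/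
theorem doob_hunt_martin_kernel_convergence {S : Type*} [Countable S] [MeasurableSpace S]
    (hms : ∀ s : Set S, MeasurableSet s)
    (q : S → S → ℝ) (hq0 : ∀ x y, 0 ≤ q x y) (hq1 : ∀ x, (∑' y, q x y) = 1)
    (htrans : ∀ x y : S, Summable fun n => qstep q n x y)
    (μ : S → ℝ) (hμ0 : ∀ x, 0 ≤ μ x) (hμ1 : (∑' x, μ x) = 1)
    (hμfin : (Function.support μ).Finite)
    (hGμ : ∀ y : S, 0 < ∑' z, μ z * GreenQ q z y)
    (x : S)
    (P : MeasureTheory.Measure (ℕ → S)) [MeasureTheory.IsProbabilityMeasure P]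
    (hchain : IsChainLaw μ q P) :
    (∀ᵐ ω ∂P, ∃ l : ℝ, Filter.Tendsto
        (fun n => GreenQ q x (ω n) / ∑' z, μ z * GreenQ q z (ω n))
        Filter.atTop (nhds l)) ∧
    Filter.Tendsto
      (fun n => ∫ ω, GreenQ q x (ω n) / (∑' z, μ z * GreenQ q z (ω n)) ∂P)
      Filter.atTop (nhds 1) := by
  have hD : DiscreteMeasurableSpace S := ⟨hms⟩
  set Q : S → S → ENNReal := fun y z => ENNReal.ofReal (q y z) with hQdef
  have hQ : ∀ y, ∑' z, Q y z = 1 := by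
    intro y
    have hs : Summable (q y) := by
      by_contra hns
      have := hq1 y
      rw [tsum_eq_zero_of_not_summable hns] at this
      exact zero_ne_one this
    rw [← ENNReal.ofReal_tsum_of_nonneg (hq0 y) hs, hq1 y, ENNReal.ofReal_one]
  have hM : DH.MarkovE Q P := DH.markov_of_law hq0 hμ0 hchain
  have hqs0 : ∀ n y z, 0 ≤ qstep q n y z := by
    intro n
    induction n with
    | zero => intro y z; simp only [qstep]; split_ifs <;> norm_num
    | succ n ih => intro y z; exact tsum_nonneg fun w => mul_nonneg (ih y w) (hq0 w z)
  have hq_le : ∀ y z, q y z ≤ 1 := by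
    intro y z
    have : Q y z ≤ 1 := (ENNReal.le_tsum z).trans (hQ y).le
    exact ENNReal.ofReal_le_one.1 this
  have hstep : ∀ n y, Summable (qstep q n y) → ∀ z, ENNReal.ofReal (qstep q (n + 1) y z) =
      ∑' w, ENNReal.ofReal (qstep q n y w) * Q w z := by
    intro n y hs z
    have : Summable fun w => qstep q n y w * q w z :=
      Summable.of_nonneg_of_le (fun w => mul_nonneg (hqs0 n y w) (hq0 w z))
        (fun w => mul_le_of_le_one_right (hqs0 n y w) (hq_le w z)) hs
    simp only [qstep]
    rw [ENNReal.ofReal_tsum_of_nonneg (fun w => mul_nonneg (hqs0 n y w) (hq0 w z)) this]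
    refine tsum_congr fun w => ?_
    rw [ENNReal.ofReal_mul (hqs0 n y w)]
  have hsum : ∀ n y, Summable (qstep q n y) := by
    intro n y
    induction n with
    | zero =>
      refine summable_of_ne_finset_zero (s := {y}) fun z hz => ?_
      have : y ≠ z := fun h => hz (by simp [h])
      simp [qstep, this]
    | succ n ih =>
      have h1 : ∑' z, ENNReal.ofReal (qstep q (n + 1) y z) ≠ ⊤ := by
        simp only [hstep n y ih]
        rw [ENNReal.tsum_comm]
        simp only [ENNReal.tsum_mul_left, hQ, mul_one]
        rw [← ENNReal.ofReal_tsum_of_nonneg (hqs0 n y) ih]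
        exact ENNReal.ofReal_ne_top
      have := ENNReal.summable_toReal h1
      simpa only [ENNReal.toReal_ofReal (hqs0 _ _ _)] using this
  have hflow : ∀ y, DH.Flow Q (fun n z => ENNReal.ofReal (qstep q n y z)) :=
    fun y n z => hstep n y (hsum n y) z
  have hG : ∀ y z, ∑' n, ENNReal.ofReal (qstep q n y z) = ENNReal.ofReal (GreenQ q y z) :=
    fun y z => (ENNReal.ofReal_tsum_of_nonneg (fun n => hqs0 n y z) (htrans y z)).symm
  have hG0 : ∀ y z, 0 ≤ GreenQ q y z := fun y z => tsum_nonneg fun n => hqs0 n y z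
  have hlaw : ∀ n z, ∫⁻ ω, DH.ind z (ω n) ∂P =
      ∑' y, ENNReal.ofReal (μ y) * ENNReal.ofReal (qstep q n y z) := by
    intro n
    induction n with
    | zero =>
      intro z
      have h1 : ∫⁻ ω, DH.ind z (ω 0) ∂P = ENNReal.ofReal (μ z) := by
        have := hchain 0 (fun _ => z)
        simp only [Finset.range_zero, Finset.prod_empty, mul_one] at this
        rw [← this]
        have hset : {ω : ℕ → S | ∀ i ≤ 0, ω i = z} = (fun ω => ω 0) ⁻¹' {z} := by
          ext ω; simp
        rw [hset, ← lintegral_indicator_one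
          ((measurable_pi_apply 0) (measurableSet_singleton z))]
        refine lintegral_congr fun ω => ?_
        simp [DH.ind, Set.indicator]
      rw [h1, tsum_eq_single z]
      · simp [qstep]
      · intro b hb; simp [qstep, hb]
    | succ n ih =>
      intro z
      refine (hM.flow0 n z).trans ?_
      simp only [ih, hstep n _ (hsum n _) z, ← ENNReal.tsum_mul_left, ← ENNReal.tsum_mul_right]
      rw [ENNReal.tsum_comm]
      simp only [mul_assoc]
  have hGm : ∀ z, ∑' n, ∫⁻ ω, DH.ind z (ω n) ∂P =
      ENNReal.ofReal (∑' y, μ y * GreenQ q y z) := by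
    intro z
    simp only [hlaw]
    rw [ENNReal.tsum_comm]
    simp only [ENNReal.tsum_mul_left, hG]
    rw [ENNReal.ofReal_tsum_of_nonneg (fun y => mul_nonneg (hμ0 y) (hG0 y z))]
    · simp only [ENNReal.ofReal_mul (hμ0 _)]
    · refine summable_of_ne_finset_zero (s := hμfin.toFinset) fun y hy => ?_
      have : μ y = 0 := by simpa using hy
      simp [this]
  have hfin : ∀ z, ∑' n, ∫⁻ ω, DH.ind z (ω n) ∂P ≠ ⊤ := fun z => by
    rw [hGm]; exact ENNReal.ofReal_ne_top
  have hpos : ∀ z, ∑' n, ∫⁻ ω, DH.ind z (ω n) ∂P ≠ 0 := fun z => by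
    rw [hGm]; exact (ENNReal.ofReal_pos.2 (hGμ z)).ne'
  set Gx : S → ENNReal := fun z => ENNReal.ofReal (GreenQ q x z) with hGx
  set Gm : S → ENNReal := fun z => ∑' n, ∫⁻ ω, DH.ind z (ω n) ∂P with hGmdef
  have hGxe : ∀ z, ∑' w, Gx w * Q w z ≤ Gx z := by
    intro z
    have := (hflow x).sum_eq z
    simp only [hG] at this
    simp only [hGx]
    rw [this]
    exact le_add_self
  have hGme : ∀ z, ∑' w, Gm w * Q w z ≤ Gm z := by
    intro z
    have := hM.flow0.sum_eq z
    simp only [hGmdef]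
    rw [this]
    exact le_add_self
  have hl0 : ∀ z, ENNReal.ofReal (qstep q 0 x z) = DH.ind x z := by
    intro z
    by_cases h : x = z
    · simp [qstep, DH.ind, h]
    · simp [qstep, DH.ind, h, Ne.symm h]
  have hGx1 : Gx x ≠ 0 := by
    have h1 : (1 : ENNReal) ≤ Gx x := by
      simp only [hGx, ← hG]
      refine le_trans ?_ (ENNReal.le_tsum 0)
      simp [qstep]
    exact (zero_lt_one.trans_le h1).ne'
  set t : ENNReal := Gm x / Gx x with ht
  have ht0 : t ≠ 0 := (ENNReal.div_pos (hpos x) ENNReal.ofReal_ne_top).ne'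
  have htT : t ≠ ⊤ := ENNReal.div_ne_top (hfin x) hGx1
  have hdom : ∀ z, t * Gx z ≤ Gm z := by
    intro z
    have := (hflow x).dominate hl0 Gm hGme t
    simp only [hG] at this
    refine this ?_ z
    exact (ENNReal.div_mul_cancel hGx1 ENNReal.ofReal_ne_top).le
  have hfC : ∀ z, Gx z / Gm z ≤ t⁻¹ := by
    intro z
    rw [ENNReal.div_le_iff_le_mul (Or.inl (hpos z)) (Or.inl (hfin z))]
    calc Gx z = t⁻¹ * (t * Gx z) := by
          rw [← mul_assoc, ENNReal.inv_mul_cancel ht0 htT, one_mul]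
      _ ≤ _ := mul_le_mul_right (hdom z) _
  have hC : t⁻¹ ≠ ⊤ := ENNReal.inv_ne_top.2 ht0
  have hconv := DH.ae_conv hM hQ hfin hpos Gx hGxe
  have hmean := DH.mean_tendsto hM hQ hfin (hflow x) hl0
    (fun z => by rw [hG]; exact ENNReal.ofReal_ne_top) (fun z => Gx z / Gm z) hC hfC
    (fun z => by rw [hG]; exact ENNReal.mul_div_cancel (hpos z) (hfin z)) hconv
  have hreal : ∀ z, GreenQ q x z / ∑' y, μ y * GreenQ q y z = (Gx z / Gm z).toReal := by
    intro z
    rw [ENNReal.toReal_div]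
    simp only [hGx, hGmdef, hGm]
    rw [ENNReal.toReal_ofReal (hG0 _ _), ENNReal.toReal_ofReal (hGμ z).le]
  simp only [hreal]
  constructor
  · filter_upwards [hconv] with ω ⟨l, hl⟩
    refine ⟨l.toReal, (ENNReal.tendsto_toReal ?_).comp hl⟩
    exact ne_top_of_le_ne_top hC (le_of_tendsto' hl fun n => hfC _)
  · have h1 : ∀ n, ∫ ω, (Gx (ω n) / Gm (ω n)).toReal ∂P =
        (∫⁻ ω, Gx (ω n) / Gm (ω n) ∂P).toReal := fun n =>
      integral_toReal (DH.meas_coord (fun z => Gx z / Gm z) n).aemeasurable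
        (Eventually.of_forall fun ω => (hfC _).trans_lt hC.lt_top)
    simp only [h1]
    exact (ENNReal.tendsto_toReal ENNReal.one_ne_top).comp hmean
end

section
/- Convergence of dipoles along the h-process: let h be a potential on a recurrent rooted network and {Y_n} the h-process started from μ_h(v)=c_{ov}h(v), v∼o. Then almost surely the dipoles g_o(·,Y_n) converge pointwise to a random potential H with E[H(x)]=h(x) for all x. If h is extremal (not a nontrivial convex combination of potentials), then H=h almost surely. -/
open scoped Classical
open Filter Topology MeasureTheory ProbabilityTheory

/-- A weighted network: an infinite, connected, locally finite graph with
positive edge conductances, encoded by a symmetric conductance function. -/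
structure Network (V : Type*) where
  c : V → V → ℝ
  symm : ∀ x y, c x y = c y x
  nonneg : ∀ x y, 0 ≤ c x y
  locFin : ∀ x, {y | 0 < c x y}.Finite
  conn : ∀ x y, Relation.ReflTransGen (fun a b => 0 < c a b) x y
  deg_pos : ∀ x, 0 < ∑' y, c x y
  infinite : Infinite V

namespace Network

variable {V : Type*} (N : Network V)

/-- Total conductance at a vertex. -/
noncomputable def cTot (x : V) : ℝ := ∑' y, N.c x y

/-- One-step transition probabilities of the network random walk. -/
noncomputable def p (x y : V) : ℝ := N.c x y / N.cTot x

/-- `n`-step transition probabilities of the network random walk. -/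
noncomputable def pstep : ℕ → V → V → ℝ
  | 0, x, y => if x = y then 1 else 0
  | n + 1, x, y => ∑' z, pstep n x z * N.p z y

/-- The network random walk is recurrent: the expected number of returns is infinite. -/
def Recurrent : Prop := ∀ x : V, ¬ Summable (fun n => N.pstep n x x)

/-- `avoid A n x y` is the probability that the walk started at `x` is at `y` at time `n`
without having visited the set `A` at any time `0,…,n`, i.e. `P_x(X_n = y, τ_A > n)`. -/
noncomputable def avoid (A : Set V) : ℕ → V → V → ℝ
  | 0, x, y => if x = y ∧ x ∉ A then 1 else 0
  | n + 1, x, y => if y ∈ A then 0 else ∑' z, avoid A n x z * N.p z y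

/-- Green kernel of the walk killed at `o`:  `G_o(x,y) = Σ_n P_x(X_n = y, τ_o > n)`. -/
noncomputable def GreenK (o x y : V) : ℝ := ∑' n, N.avoid {o} n x y

/-- Green density of the walk killed at `o`:  `g_o(x,y) = G_o(x,y)/c_y`. -/
noncomputable def g (o x y : V) : ℝ := N.GreenK o x y / N.cTot y

/-- The network Laplacian `Δf(v) = Σ_x c_{vx}(f(x) − f(v))`. -/
noncomputable def lap (f : V → ℝ) (v : V) : ℝ := ∑' x, N.c v x * (f x - f v)

/-- A potential on the rooted network `(G,c,o)`: a nonnegative function vanishing at `o`,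
with Laplacian `1` at `o` and harmonic elsewhere. -/
def IsPotential (o : V) (h : V → ℝ) : Prop :=
  (∀ v, 0 ≤ h v) ∧ h o = 0 ∧ N.lap h o = 1 ∧ ∀ v, v ≠ o → N.lap h v = 0

/-- Harmonic measure from `v` on a set `A`:  `ω_v^A(z) = P_v(X_{τ_A} = z)`. -/
noncomputable def harm (A : Set V) (v z : V) : ℝ :=
  if v ∈ A then (if v = z then 1 else 0)
  else if z ∈ A then ∑' n, ∑' w, N.avoid A n v w * N.p w z
  else 0

/-- Effective resistance `R_eff(x ↔ y) = g_x(y,y)`. -/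
noncomputable def Reff (x y : V) : ℝ := N.g x y y

/-- Transition probabilities of the Doob `h`-transform: `p^h(x,y) = p(x,y) h(y)/h(x)`. -/
noncomputable def ph (h : V → ℝ) (x y : V) : ℝ := N.p x y * h y / h x

/-- `n`-step transition probabilities of the `h`-process. -/
noncomputable def phstep (h : V → ℝ) : ℕ → V → V → ℝ
  | 0, x, y => if x = y then 1 else 0
  | n + 1, x, y => ∑' z, phstep h n x z * N.ph h z y

/-- The initial distribution `μ_h(v) = c_{ov} h(v)`. -/
noncomputable def muh (o : V) (h : V → ℝ) (v : V) : ℝ := N.c o v * h v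

end Network

namespace DipoleAux
open scoped ENNReal

variable {V : Type*}

/-- Powers of a nonnegative kernel. -/
noncomputable def kpow (k : V → V → ℝ≥0∞) : ℕ → V → V → ℝ≥0∞
  | 0, x, y => if x = y then 1 else 0
  | n + 1, x, y => ∑' z, kpow k n x z * k z y

/-- Probability of being killed exactly at step `n + 1`. -/
noncomputable def J (k : V → V → ℝ≥0∞) (κ : V → ℝ≥0∞) : ℕ → V → ℝ≥0∞
  | 0, x => κ x
  | n + 1, x => ∑' z, k x z * J k κ n z

/-- Green kernel. -/
noncomputable def GK (k : V → V → ℝ≥0∞) (x y : V) : ℝ≥0∞ := ∑' n, kpow k n x y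

lemma kpow_succ_left (k : V → V → ℝ≥0∞) (n : ℕ) : ∀ x y,
    kpow k (n + 1) x y = ∑' z, k x z * kpow k n z y := by
  induction n with
  | zero =>
    intro x y
    simp only [kpow]
    rw [tsum_eq_single x (by intro b hb; simp [hb.symm]), tsum_eq_single y (by intro b hb; simp [hb])]
    simp
  | succ n ih =>
    intro x y
    rw [kpow]
    simp_rw [ih x, ← ENNReal.tsum_mul_right]
    rw [ENNReal.tsum_comm]
    refine tsum_congr fun z => ?_
    rw [kpow, ← ENNReal.tsum_mul_left]
    simp_rw [mul_assoc]

lemma kpow_symm (k : V → V → ℝ≥0∞) (m : V → ℝ≥0∞) (hk : ∀ x y, m x * k x y = m y * k y x)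
    (n : ℕ) : ∀ x y, m x * kpow k n x y = m y * kpow k n y x := by
  induction n with
  | zero =>
    intro x y
    by_cases h : x = y
    · subst h; rfl
    · simp [kpow, h, Ne.symm h]
  | succ n ih =>
    intro x y
    rw [kpow_succ_left k n y x, kpow, ← ENNReal.tsum_mul_left, ← ENNReal.tsum_mul_left]
    refine tsum_congr fun z => ?_
    rw [← mul_assoc, ih x z, mul_right_comm, hk z y]
    ring

lemma kpow_J (k : V → V → ℝ≥0∞) (κ : V → ℝ≥0∞) (m : ℕ) (n : ℕ) : ∀ x,
    ∑' y, kpow k n x y * J k κ m y = J k κ (n + m) x := by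
  induction n with
  | zero =>
    intro x
    rw [tsum_eq_single x (by intro b hb; simp [kpow, hb.symm])]
    simp [kpow]
  | succ n ih =>
    intro x
    rw [show n + 1 + m = (n + m) + 1 by ring, J]
    simp_rw [kpow_succ_left, ← ENNReal.tsum_mul_right]
    rw [ENNReal.tsum_comm]
    refine tsum_congr fun z => ?_
    rw [← ih z, ← ENNReal.tsum_mul_left]
    simp_rw [mul_assoc]

lemma J_sum_succ (k : V → V → ℝ≥0∞) (κ : V → ℝ≥0∞) (M : ℕ) (x : V) :
    ∑ n ∈ Finset.range (M + 1), J k κ n x =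
      κ x + ∑' z, k x z * ∑ n ∈ Finset.range M, J k κ n z := by
  rw [Finset.sum_range_succ', add_comm]
  simp_rw [J, Finset.mul_sum]
  rw [Summable.tsum_finsetSum (fun _ _ => ENNReal.summable)]

lemma J_sum_le (k : V → V → ℝ≥0∞) (κ : V → ℝ≥0∞) (hs : ∀ x, κ x + ∑' z, k x z ≤ 1)
    (M : ℕ) : ∀ x, ∑ n ∈ Finset.range M, J k κ n x ≤ 1 := by
  induction M with
  | zero => intro x; simp
  | succ M ih =>
    intro x
    rw [J_sum_succ]
    refine le_trans (add_le_add le_rfl (ENNReal.tsum_le_tsum fun z => ?_)) (hs x)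
    exact (mul_le_mul' le_rfl (ih z)).trans (by simp)

lemma J_tsum_le (k : V → V → ℝ≥0∞) (κ : V → ℝ≥0∞) (hs : ∀ x, κ x + ∑' z, k x z ≤ 1)
    (x : V) : ∑' n, J k κ n x ≤ 1 := by
  rw [ENNReal.tsum_eq_iSup_nat]
  exact iSup_le fun M => J_sum_le k κ hs M x

lemma J_tsum_eq (k : V → V → ℝ≥0∞) (κ : V → ℝ≥0∞) (x : V) :
    ∑' n, J k κ n x = κ x + ∑' z, k x z * ∑' n, J k κ n z := by
  rw [tsum_eq_zero_add' ENNReal.summable]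
  simp_rw [J, ← ENNReal.tsum_mul_left]
  rw [ENNReal.tsum_comm]

lemma GK_J (k : V → V → ℝ≥0∞) (κ : V → ℝ≥0∞) (m : ℕ) (x : V) :
    ∑' y, GK k x y * J k κ m y = ∑' n, J k κ (n + m) x := by
  simp_rw [GK, ← ENNReal.tsum_mul_right]
  rw [ENNReal.tsum_comm]
  simp_rw [kpow_J]

lemma GK_mul_J_le (k : V → V → ℝ≥0∞) (κ : V → ℝ≥0∞) (hs : ∀ x, κ x + ∑' z, k x z ≤ 1)
    (m : ℕ) (x y : V) : GK k x y * J k κ m y ≤ 1 := by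
  refine le_trans (ENNReal.le_tsum (f := fun y => GK k x y * J k κ m y) y) ?_
  rw [GK_J]
  refine le_trans ?_ (J_tsum_le k κ hs x)
  exact ENNReal.tsum_comp_le_tsum_of_injective (add_left_injective m) _

lemma GK_left (k : V → V → ℝ≥0∞) (x y : V) :
    GK k x y = (if x = y then 1 else 0) + ∑' z, k x z * GK k z y := by
  rw [GK, tsum_eq_zero_add' ENNReal.summable]
  simp_rw [kpow_succ_left, GK, ← ENNReal.tsum_mul_left]
  rw [ENNReal.tsum_comm, kpow]

lemma GK_symm (k : V → V → ℝ≥0∞) (m : V → ℝ≥0∞) (hk : ∀ x y, m x * k x y = m y * k y x)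
    (x y : V) : m x * GK k x y = m y * GK k y x := by
  simp_rw [GK, ← ENNReal.tsum_mul_left, kpow_symm k m hk _ x y]

/-- Sum over killed paths from `y` of length `n + 1`. -/
noncomputable def I (k : V → V → ℝ≥0∞) (κ : V → ℝ≥0∞) :
    ℕ → V → (List V → ℝ≥0∞) → ℝ≥0∞
  | 0, y, φ => κ y * φ [y]
  | n + 1, y, φ => ∑' z, k y z * I k κ n z (fun l => φ (y :: l))

lemma I_add (k : V → V → ℝ≥0∞) (κ : V → ℝ≥0∞) (n : ℕ) : ∀ y φ ψ,
    I k κ n y (fun l => φ l + ψ l) = I k κ n y φ + I k κ n y ψ := by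
  induction n with
  | zero => intro y φ ψ; simp [I, mul_add]
  | succ n ih =>
    intro y φ ψ
    simp only [I]
    rw [← ENNReal.tsum_add]
    refine tsum_congr fun z => ?_
    rw [ih z (fun l => φ (y :: l)) (fun l => ψ (y :: l)), mul_add]

lemma I_const (k : V → V → ℝ≥0∞) (κ : V → ℝ≥0∞) (c : ℝ≥0∞) (n : ℕ) : ∀ y,
    I k κ n y (fun _ => c) = J k κ n y * c := by
  induction n with
  | zero => intro y; simp [I, J]
  | succ n ih =>
    intro y
    simp only [I, J]
    rw [← ENNReal.tsum_mul_right]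
    refine tsum_congr fun z => ?_
    rw [ih z, mul_assoc]

lemma I_head (k : V → V → ℝ≥0∞) (κ : V → ℝ≥0∞) (o : V) (e : V → ℝ≥0∞) (n : ℕ) (y : V) :
    I k κ n y (fun l => e (l.headD o)) = J k κ n y * e y := by
  cases n with
  | zero => simp [I, J]
  | succ n =>
    simp only [I, J, List.headD_cons, I_const]
    rw [← ENNReal.tsum_mul_right]
    simp_rw [mul_assoc]

/-- Crossing counter: `true` waits for a value below `a`, `false` for a value above `b`. -/
noncomputable def cr (f : V → ℝ≥0∞) (a b : ℝ≥0∞) : Bool → List V → ℝ≥0∞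
  | _, [] => 0
  | true, y :: l => if f y < a then cr f a b false l else cr f a b true l
  | false, y :: l => if b < f y then 1 + cr f a b true l else cr f a b false l

lemma cr_le (f : V → ℝ≥0∞) (a b : ℝ≥0∞) (hab : a ≤ b) (l : List V) :
    cr f a b true l ≤ cr f a b false l ∧ cr f a b false l ≤ 1 + cr f a b true l := by
  induction l with
  | nil => simp [cr]
  | cons y l ih =>
    simp only [cr]
    by_cases h1 : f y < a
    · have h2 : ¬ b < f y := not_lt.2 (h1.le.trans hab)
      simp [h1, h2]
    · by_cases h2 : b < f y
      · simp [h1, h2]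
      · simp only [h1, h2, if_false]; exact ih

lemma cr_cons_ge (f : V → ℝ≥0∞) (a b : ℝ≥0∞) (hab : a ≤ b) (s : Bool) (y : V) (l : List V) :
    cr f a b s l ≤ cr f a b s (y :: l) := by
  have h := cr_le f a b hab l
  cases s
  · simp only [cr]
    split_ifs
    · exact h.2
    · exact le_rfl
  · simp only [cr]
    split_ifs
    · exact h.1
    · exact le_rfl

lemma I_sum_succ (k : V → V → ℝ≥0∞) (κ : V → ℝ≥0∞) (φ : List V → ℝ≥0∞) (M : ℕ) (y : V) :
    ∑ n ∈ Finset.range (M + 1), I k κ n y φ =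
      κ y * φ [y] + ∑' z, k y z * ∑ n ∈ Finset.range M, I k κ n z (fun l => φ (y :: l)) := by
  rw [Finset.sum_range_succ', add_comm]
  simp_rw [I, Finset.mul_sum]
  rw [Summable.tsum_finsetSum (fun _ _ => ENNReal.summable)]

lemma crossing_bound (k : V → V → ℝ≥0∞) (κ : V → ℝ≥0∞) (hs : ∀ x, κ x + ∑' z, k x z ≤ 1)
    (f : V → ℝ≥0∞) (hf : ∀ y, ∑' z, k y z * f z ≤ f y) (a δ : ℝ≥0∞) (M : ℕ) : ∀ y,
    δ * ∑ n ∈ Finset.range M, I k κ n y (cr f a (a + δ) true) ≤ a ∧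
    δ * ∑ n ∈ Finset.range M, I k κ n y (cr f a (a + δ) false) ≤ f y := by
  have hk1 : ∀ y, ∑' z, k y z ≤ 1 := fun y => le_trans le_add_self (hs y)
  induction M with
  | zero => intro y; simp
  | succ M ih =>
    have lo : ∀ y, δ * ∑' z, k y z * ∑ n ∈ Finset.range M, I k κ n z (cr f a (a + δ) false)
        ≤ f y := by
      intro y
      rw [← ENNReal.tsum_mul_left]
      refine le_trans (ENNReal.tsum_le_tsum fun z => ?_) (hf y)
      rw [mul_left_comm]
      exact mul_le_mul' le_rfl (ih z).2
    have hi : ∀ y, δ * ∑' z, k y z * ∑ n ∈ Finset.range M, I k κ n z (cr f a (a + δ) true)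
        ≤ a := by
      intro y
      rw [← ENNReal.tsum_mul_left]
      calc _ ≤ ∑' z, k y z * a := by
              refine ENNReal.tsum_le_tsum fun z => ?_
              rw [mul_left_comm]
              exact mul_le_mul' le_rfl (ih z).1
        _ = (∑' z, k y z) * a := ENNReal.tsum_mul_right
        _ ≤ 1 * a := mul_le_mul' (hk1 y) le_rfl
        _ = a := one_mul a
    intro y
    constructor
    · rw [I_sum_succ]
      by_cases h1 : f y < a
      · simp only [cr, h1, if_true, mul_zero, zero_add]
        exact (lo y).trans h1.le
      · simp only [cr, h1, if_false, mul_zero, zero_add]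
        exact hi y
    · rw [I_sum_succ]
      by_cases h2 : a + δ < f y
      · simp only [cr, h2, if_true, add_zero, mul_one]
        simp_rw [I_add, I_const, mul_one, Finset.sum_add_distrib, mul_add]
        rw [ENNReal.tsum_add, ← mul_add, ← add_assoc, ← J_sum_succ, mul_add]
        refine le_trans ?_ h2.le
        refine le_trans (add_le_add ?_ (hi y)) (add_comm δ a).le
        exact (mul_le_mul' le_rfl (J_sum_le k κ hs _ y)).trans (by simp)
      · simp only [cr, h2, if_false, mul_zero, zero_add]
        exact lo y

lemma crossing_tsum (k : V → V → ℝ≥0∞) (κ : V → ℝ≥0∞) (hs : ∀ x, κ x + ∑' z, k x z ≤ 1)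
    (f : V → ℝ≥0∞) (hf : ∀ y, ∑' z, k y z * f z ≤ f y) (a δ : ℝ≥0∞) (y : V) :
    δ * ∑' n, I k κ n y (cr f a (a + δ) true) ≤ a := by
  rw [ENNReal.tsum_eq_iSup_nat, ENNReal.mul_iSup]
  exact iSup_le fun M => (crossing_bound k κ hs f hf a δ M y).1

/-- `h` times the probability that the `h`-process avoids `F` at the next `j` steps. -/
noncomputable def rho (k : V → V → ℝ≥0∞) (h : V → ℝ≥0∞) (F : Set V) : ℕ → V → ℝ≥0∞
  | 0, y => h y
  | j + 1, y => ∑' z, k y z * (if z ∈ F then 0 else rho k h F j z)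

lemma rho_succ_le (k : V → V → ℝ≥0∞) (h : V → ℝ≥0∞) (hh : ∀ y, ∑' z, k y z * h z = h y)
    (F : Set V) (j : ℕ) : ∀ y, rho k h F (j + 1) y ≤ rho k h F j y := by
  induction j with
  | zero =>
    intro y
    simp only [rho]
    conv_rhs => rw [← hh y]
    refine ENNReal.tsum_le_tsum fun z => mul_le_mul' le_rfl ?_
    split_ifs <;> simp
  | succ j ih =>
    intro y
    rw [rho, rho]
    refine ENNReal.tsum_le_tsum fun z => mul_le_mul' le_rfl ?_
    split_ifs
    · exact le_rfl
    · exact ih z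

lemma rho_antitone (k : V → V → ℝ≥0∞) (h : V → ℝ≥0∞) (hh : ∀ y, ∑' z, k y z * h z = h y)
    (F : Set V) (y : V) : Antitone (fun j => rho k h F j y) :=
  antitone_nat_of_succ_le fun j => rho_succ_le k h hh F j y

lemma last_exit (k : V → V → ℝ≥0∞) (h : V → ℝ≥0∞) (hh : ∀ y, ∑' z, k y z * h z = h y)
    (F : Set V) (j : ℕ) : ∀ x,
    (∑ n ∈ Finset.range (j + 1), ∑' y, kpow k n x y * (if y ∈ F then rho k h F (j - n) y else 0))
      + (if x ∈ F then 0 else rho k h F j x) = h x := by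
  induction j with
  | zero =>
    intro x
    simp only [zero_add, Finset.range_one, Finset.sum_singleton, kpow]
    rw [tsum_eq_single x (by intro b hb; simp [hb.symm])]
    by_cases hx : x ∈ F <;> simp [hx, rho]
  | succ j ih =>
    intro x
    rw [Finset.sum_range_succ']
    simp only [kpow, Nat.sub_zero, Nat.add_sub_add_right]
    rw [tsum_eq_single x (by intro b hb; simp [hb.symm])]
    have h1 : ∑ n ∈ Finset.range (j + 1), ∑' y, (∑' z, kpow k n x z * k z y) *
        (if y ∈ F then rho k h F (j - n) y else 0) = ∑' z, k x z *
        (∑ n ∈ Finset.range (j + 1), ∑' y, kpow k n z y *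
          (if y ∈ F then rho k h F (j - n) y else 0)) := by
      simp_rw [Finset.mul_sum]
      rw [Summable.tsum_finsetSum (fun _ _ => ENNReal.summable)]
      refine Finset.sum_congr rfl fun n _ => ?_
      have : ∀ y, ∑' z, kpow k n x z * k z y = ∑' z, k x z * kpow k n z y := fun y => by
        rw [← kpow_succ_left, kpow]
      simp_rw [this, ← ENNReal.tsum_mul_right, ← ENNReal.tsum_mul_left]
      rw [ENNReal.tsum_comm]
      simp_rw [mul_assoc]
    rw [h1, add_assoc]
    have h2 : (if x = x then (1:ℝ≥0∞) else 0) * (if x ∈ F then rho k h F (j + 1) x else 0) +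
        (if x ∈ F then 0 else rho k h F (j + 1) x) = rho k h F (j + 1) x := by
      by_cases hx : x ∈ F <;> simp [hx]
    rw [h2, rho, ← ENNReal.tsum_add]
    simp_rw [← mul_add, ih]
    exact hh x

lemma last_exit_limit (k : V → V → ℝ≥0∞) (h : V → ℝ≥0∞) (hh : ∀ y, ∑' z, k y z * h z = h y)
    (F : Set V) (hF : F.Finite) (x : V) (hx : x ∈ F)
    (hG : ∀ y ∈ F, GK k x y * h y ≠ ∞) :
    ∑' y, GK k x y * (if y ∈ F then ⨅ j, rho k h F j y else 0) = h x := by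
  have hsum : ∀ (u : V → V → ℝ≥0∞) (v : V → ℝ≥0∞),
      ∑' y, u x y * (if y ∈ F then v y else 0) = ∑ y ∈ hF.toFinset, u x y * v y := by
    intro u v
    rw [tsum_eq_sum (s := hF.toFinset)]
    · refine Finset.sum_congr rfl fun y hy => ?_
      rw [if_pos (by simpa using hy)]
    · intro y hy
      rw [if_neg (by simpa using hy), mul_zero]
  have hle := fun j => last_exit k h hh F j x
  simp only [if_pos hx, add_zero] at hle
  rw [hsum (GK k) (fun y => ⨅ j, rho k h F j y)]
  have hT : ∀ y ∈ hF.toFinset, Tendsto (fun j => ∑' n, if n < j + 1 then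
      kpow k n x y * rho k h F (j - n) y else 0) atTop
      (𝓝 (GK k x y * ⨅ j, rho k h F j y)) := by
    intro y hy
    rw [GK, ← ENNReal.tsum_mul_right]
    have hy' : y ∈ F := by simpa using hy
    have key := tendsto_lintegral_of_dominated_convergence (μ := (Measure.count : Measure ℕ))
      (F := fun j n => if n < j + 1 then kpow k n x y * rho k h F (j - n) y else 0)
      (f := fun n => kpow k n x y * ⨅ j, rho k h F j y)
      (fun n => kpow k n x y * h y) (fun n => measurable_from_top)
      (fun j => Eventually.of_forall fun n => by
        dsimp only
        split_ifs
        · exact mul_le_mul' le_rfl (rho_antitone k h hh F y (Nat.zero_le _))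
        · exact zero_le)
      (by
        rw [lintegral_count, ENNReal.tsum_mul_right]
        exact hG y hy')
      (Eventually.of_forall fun n => by
        by_cases hhy : h y = 0
        · have hz : ∀ j, rho k h F j y = 0 := fun j =>
            le_antisymm ((rho_antitone k h hh F y (Nat.zero_le j)).trans (le_of_eq hhy)) zero_le
          simp [hz]
        have hk : kpow k n x y ≠ ∞ := by
          intro hk
          apply hG y hy'
          have : GK k x y = ∞ := by
            refine top_le_iff.1 ?_
            rw [← hk]
            exact ENNReal.le_tsum (f := fun n => kpow k n x y) n
          rw [this, ENNReal.top_mul hhy]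
        have h1 : Tendsto (fun j => rho k h F (j - n) y) atTop (𝓝 (⨅ j, rho k h F j y)) :=
          (tendsto_atTop_iInf (rho_antitone k h hh F y)).comp (tendsto_sub_atTop_nat n)
        have h2 := ENNReal.Tendsto.const_mul h1 (Or.inr hk)
        refine h2.congr' ?_
        filter_upwards [eventually_ge_atTop n] with j hj
        rw [if_pos (by omega)])
    simpa [lintegral_count] using key
  have hT2 := tendsto_finsetSum _ hT
  refine tendsto_nhds_unique hT2 ?_
  refine tendsto_const_nhds.congr fun j => ?_
  rw [← hle j]
  have : ∀ y, (∑' n, if n < j + 1 then kpow k n x y * rho k h F (j - n) y else 0) =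
      ∑ n ∈ Finset.range (j + 1), kpow k n x y * rho k h F (j - n) y := by
    intro y
    rw [tsum_eq_sum (s := Finset.range (j + 1))]
    · refine Finset.sum_congr rfl fun n hn => ?_
      rw [if_pos (by simpa using hn)]
    · intro n hn
      rw [if_neg (by simpa using hn)]
  simp_rw [this]
  rw [Finset.sum_comm]
  refine Finset.sum_congr rfl fun n _ => ?_
  rw [hsum (kpow k n) (rho k h F (j - n))]

end DipoleAux

namespace DipoleAux
open scoped ENNReal

section Prob
set_option linter.unusedSectionVars false
variable {V : Type*}

/-- The reversed initial segment of a trajectory. -/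
def revl (ω : ℕ → V) : ℕ → List V
  | 0 => [ω 0]
  | n + 1 => ω (n + 1) :: revl ω n

lemma revl_headD (o : V) (ω : ℕ → V) (n : ℕ) : (revl ω n).headD o = ω n := by
  cases n <;> simp [revl]

lemma revl_eq_iff (ω v : ℕ → V) (n : ℕ) : revl ω n = revl v n ↔ ∀ i ≤ n, ω i = v i := by
  induction n with
  | zero => simp [revl]
  | succ n ih =>
    simp only [revl, List.cons.injEq, ih]
    constructor
    · rintro ⟨h1, h2⟩ i hi
      rcases Nat.lt_or_ge n i with h | h
      · have : i = n + 1 := by omega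
        rw [this]; exact h1
      · exact h2 i h
    · intro h
      exact ⟨h _ le_rfl, fun i hi => h i (by omega)⟩

lemma meas_of_atoms {Ω β : Type*} [MeasurableSpace Ω] [Countable β] (T : Ω → β)
    (hT : ∀ b, MeasurableSet (T ⁻¹' {b})) (F : β → ℝ≥0∞) : Measurable fun ω => F (T ω) := by
  let _ : MeasurableSpace β := ⊤
  have h1 : Measurable T := measurable_to_countable' hT
  have h2 : Measurable F := measurable_from_top
  exact h2.comp h1

lemma lintegral_atoms {Ω β : Type*} [MeasurableSpace Ω] [Countable β] (P : Measure Ω) (T : Ω → β)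
    (hT : ∀ b, MeasurableSet (T ⁻¹' {b})) (F : β → ℝ≥0∞) :
    ∫⁻ ω, F (T ω) ∂P = ∑' b, F b * P (T ⁻¹' {b}) := by
  let _ : MeasurableSpace β := ⊤
  have h1 : Measurable T := measurable_to_countable' hT
  have h2 : Measurable F := measurable_from_top
  rw [← lintegral_map h2 h1, lintegral_countable']
  refine tsum_congr fun b => ?_
  rw [Measure.map_apply h1 (by trivial)]

variable [MeasurableSpace V]

lemma meas_coord (hms : ∀ s : Set V, MeasurableSet s) (n : ℕ) (s : Set V) :
    MeasurableSet {ω : ℕ → V | ω n ∈ s} := (measurable_pi_apply n) (hms s)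

lemma meas_revl (hms : ∀ s : Set V, MeasurableSet s) (n : ℕ) : ∀ l : List V,
    MeasurableSet ((fun ω : ℕ → V => revl ω n) ⁻¹' {l}) := by
  induction n with
  | zero =>
    intro l
    have : ((fun ω : ℕ → V => revl ω 0) ⁻¹' {l}) = {ω | ω 0 ∈ {y | [y] = l}} := by
      ext ω; simp [revl]
    rw [this]
    exact meas_coord hms 0 _
  | succ n ih =>
    intro l
    cases l with
    | nil =>
      convert MeasurableSet.empty
      ext ω; simp [revl]
    | cons y l =>
      have : ((fun ω : ℕ → V => revl ω (n + 1)) ⁻¹' {y :: l}) =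
          {ω | ω (n + 1) ∈ ({y} : Set V)} ∩ ((fun ω : ℕ → V => revl ω n) ⁻¹' {l}) := by
        ext ω; simp [revl]
      rw [this]
      exact (meas_coord hms _ _).inter (ih l)

variable [Countable V]

lemma measurable_revl (hms : ∀ s : Set V, MeasurableSet s) (n : ℕ) (φ : List V → ℝ≥0∞) :
    Measurable fun ω : ℕ → V => φ (revl ω n) := meas_of_atoms _ (meas_revl hms n) φ

lemma measurable_coord (hms : ∀ s : Set V, MeasurableSet s) (n : ℕ) (φ : V → ℝ≥0∞) :
    Measurable fun ω : ℕ → V => φ (ω n) :=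
  meas_of_atoms (fun ω : ℕ → V => ω n) (fun b => meas_coord hms n {b}) φ

/-- One step Markov property, in terms of a transition kernel `q`. -/
def Markov (q : V → V → ℝ≥0∞) (P : Measure (ℕ → V)) : Prop :=
  ∀ (n : ℕ) (v : ℕ → V), P {ω | ∀ i ≤ n + 1, ω i = v i} =
    P {ω | ∀ i ≤ n, ω i = v i} * q (v n) (v (n + 1))

lemma markov_atom (o : V) (q : V → V → ℝ≥0∞) (P : Measure (ℕ → V)) (hP : Markov q P)
    (n : ℕ) (y : V) (l : List V) :
    P ({ω | ω (n + 1) = y} ∩ {ω | revl ω n = l}) =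
      P {ω | revl ω n = l} * q (l.headD o) y := by
  by_cases hl : ∃ v : ℕ → V, revl v n = l
  · obtain ⟨v, rfl⟩ := hl
    have h := hP n (Function.update v (n + 1) y)
    have e1 : {ω : ℕ → V | ∀ i ≤ n, ω i = Function.update v (n + 1) y i} =
        {ω | revl ω n = revl v n} := by
      ext ω
      simp only [Set.mem_ofPred_eq, revl_eq_iff]
      refine forall₂_congr fun i hi => ?_
      rw [Function.update_of_ne (by omega)]
    have e2 : {ω : ℕ → V | ∀ i ≤ n + 1, ω i = Function.update v (n + 1) y i} =
        {ω | ω (n + 1) = y} ∩ {ω | revl ω n = revl v n} := by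
      rw [← e1]
      ext ω
      simp only [Set.mem_ofPred_eq, Set.mem_inter_iff]
      constructor
      · intro h
        exact ⟨by simpa using h (n + 1) le_rfl, fun i hi => h i (by omega)⟩
      · rintro ⟨h1, h2⟩ i hi
        rcases Nat.lt_or_ge n i with h | h
        · have : i = n + 1 := by omega
          rw [this, h1]; simp
        · exact h2 i h
    rw [e1, e2] at h
    rw [h, revl_headD]
    simp
  · have : {ω : ℕ → V | revl ω n = l} = ∅ := by
      ext ω; simp only [Set.mem_ofPred_eq, Set.mem_empty_iff_false, iff_false]
      intro h; exact hl ⟨ω, h⟩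
    simp [this]

lemma markov_step (hms : ∀ s : Set V, MeasurableSet s) (o : V) (q : V → V → ℝ≥0∞)
    (P : Measure (ℕ → V)) (hP : Markov q P) (n : ℕ) (ψ : V → List V → ℝ≥0∞) :
    ∫⁻ ω, ψ (ω (n + 1)) (revl ω n) ∂P =
      ∫⁻ ω, ∑' y, q (ω n) y * ψ y (revl ω n) ∂P := by
  have h1 := lintegral_atoms P (fun ω : ℕ → V => (ω (n + 1), revl ω n))
    (fun b => by
      have : (fun ω : ℕ → V => (ω (n + 1), revl ω n)) ⁻¹' {b} =
        {ω | ω (n + 1) ∈ ({b.1} : Set V)} ∩ ((fun ω : ℕ → V => revl ω n) ⁻¹' {b.2}) := by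
          ext ω; simp [Prod.ext_iff]
      rw [this]
      exact (meas_coord hms _ _).inter (meas_revl hms n _)) (fun b => ψ b.1 b.2)
  have h2 := lintegral_atoms P (fun ω : ℕ → V => revl ω n) (meas_revl hms n)
    (fun l => ∑' y, q (l.headD o) y * ψ y l)
  simp only [revl_headD] at h2
  rw [h1, h2, ENNReal.tsum_prod', ENNReal.tsum_comm]
  refine tsum_congr fun l => ?_
  rw [← ENNReal.tsum_mul_right]
  refine tsum_congr fun y => ?_
  have h3 := markov_atom o q P hP n y l
  have : (fun ω : ℕ → V => (ω (n + 1), revl ω n)) ⁻¹' {(y, l)} =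
      {ω | ω (n + 1) = y} ∩ {ω | revl ω n = l} := by
    ext ω; simp
  dsimp only
  rw [this, h3, show (fun ω : ℕ → V => revl ω n) ⁻¹' {l} = {ω | revl ω n = l} from rfl]
  ring

/-- Probability that the chain avoids `F` at the next `j` steps. -/
noncomputable def ravoid (q : V → V → ℝ≥0∞) (F : Set V) : ℕ → V → ℝ≥0∞
  | 0, _ => 1
  | j + 1, y => ∑' z, q y z * (if z ∈ F then 0 else ravoid q F j z)

lemma markov_avoid (hms : ∀ s : Set V, MeasurableSet s) (o : V) (q : V → V → ℝ≥0∞)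
    (P : Measure (ℕ → V)) (hP : Markov q P) (F : Set V) (j : ℕ) :
    ∀ (n : ℕ) (φ : List V → ℝ≥0∞),
    ∫⁻ ω, φ (revl ω n) * (if ∀ i < j, ω (n + 1 + i) ∉ F then 1 else 0) ∂P =
      ∫⁻ ω, φ (revl ω n) * ravoid q F j (ω n) ∂P := by
  induction j with
  | zero => intro n φ; simp [ravoid]
  | succ j ih =>
    intro n φ
    obtain ⟨u, hu⟩ : ∃ u : V → ℝ≥0∞, ∀ y, u y = if y ∈ F then 0 else 1 := ⟨_, fun _ => rfl⟩
    have h := ih (n + 1) (fun l => φ l.tail * u (l.headD o))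
    have h2 := markov_step hms o q P hP n (fun y l => φ l * u y * ravoid q F j y)
    simp only [revl, List.tail_cons, List.headD_cons] at h
    rw [h2] at h
    have e1 : ∀ ω : ℕ → V, φ (revl ω n) * (if ∀ i < j + 1, ω (n + 1 + i) ∉ F then 1 else 0) =
        φ (revl ω n) * u (ω (n + 1)) *
          (if ∀ i < j, ω (n + 1 + 1 + i) ∉ F then 1 else 0) := by
      intro ω
      have : (∀ i < j + 1, ω (n + 1 + i) ∉ F) ↔
          ω (n + 1) ∉ F ∧ ∀ i < j, ω (n + 1 + 1 + i) ∉ F := by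
        rw [Nat.forall_lt_succ_left]
        simp only [add_zero]
        refine and_congr_right fun _ => forall₂_congr fun i _ => ?_
        rw [show n + 1 + (i + 1) = n + 1 + 1 + i by ring]
      rw [mul_assoc, hu]
      congr 1
      by_cases h1 : ω (n + 1) ∈ F <;> by_cases h2 : ∀ i < j, ω (n + 1 + 1 + i) ∉ F <;>
        simp only [this, h1, h2] <;> simp
    simp_rw [e1]
    rw [h]
    refine lintegral_congr fun ω => ?_
    rw [ravoid, ← ENNReal.tsum_mul_left]
    refine tsum_congr fun z => ?_
    rw [hu]
    by_cases hz : z ∈ F <;> simp [hz]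
    ring

/-- The indicator that `n` is the last exit time from `F`. -/
noncomputable def lastI (F : Set V) (n : ℕ) (ω : ℕ → V) : ℝ≥0∞ :=
  if ω n ∈ F ∧ ∀ m, n < m → ω m ∉ F then 1 else 0

lemma meas_never (hms : ∀ s : Set V, MeasurableSet s) (F : Set V) (n : ℕ) :
    MeasurableSet {ω : ℕ → V | ∀ m, n < m → ω m ∉ F} := by
  have : {ω : ℕ → V | ∀ m, n < m → ω m ∉ F} = ⋂ m, ⋂ (_ : n < m), {ω | ω m ∈ Fᶜ} := by
    ext ω; simp
  rw [this]
  exact MeasurableSet.iInter fun m => MeasurableSet.iInter fun _ => meas_coord hms m _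

lemma measurable_lastI (hms : ∀ s : Set V, MeasurableSet s) (F : Set V) (n : ℕ) :
    Measurable (lastI F n) := by
  unfold lastI
  refine Measurable.ite ?_ measurable_const measurable_const
  exact (meas_coord hms n F).inter (meas_never hms F n)

lemma ravoid_antitone_of (hms : ∀ s : Set V, MeasurableSet s) (o : V) (q : V → V → ℝ≥0∞)
    (P : Measure (ℕ → V)) [IsProbabilityMeasure P] (hP : Markov q P) (F : Set V)
    (n : ℕ) (l : List V) :
    P ({ω | revl ω n = l} ∩ {ω | ∀ m, n < m → ω m ∉ F}) =
      P {ω | revl ω n = l} * ⨅ j, ravoid q F j (l.headD o) := by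
  have hj : ∀ j, P ({ω | revl ω n = l} ∩ {ω | ∀ i < j, ω (n + 1 + i) ∉ F}) =
      P {ω | revl ω n = l} * ravoid q F j (l.headD o) := by
    intro j
    have h := markov_avoid hms o q P hP F j n (fun l' => if l' = l then 1 else 0)
    have hm1 : MeasurableSet {ω : ℕ → V | revl ω n = l} := meas_revl hms n l
    have hm2 : MeasurableSet {ω : ℕ → V | ∀ i < j, ω (n + 1 + i) ∉ F} := by
      have : {ω : ℕ → V | ∀ i < j, ω (n + 1 + i) ∉ F} =
          ⋂ i, ⋂ (_ : i < j), {ω | ω (n + 1 + i) ∈ Fᶜ} := by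
        ext ω; simp
      rw [this]
      exact MeasurableSet.iInter fun m => MeasurableSet.iInter fun _ => meas_coord hms _ _
    have e1 : ∀ ω : ℕ → V, (if revl ω n = l then (1:ℝ≥0∞) else 0) *
        (if ∀ i < j, ω (n + 1 + i) ∉ F then 1 else 0) =
        ({ω | revl ω n = l} ∩ {ω | ∀ i < j, ω (n + 1 + i) ∉ F}).indicator 1 ω := by
      intro ω
      by_cases h1 : revl ω n = l <;> by_cases h2 : ∀ i < j, ω (n + 1 + i) ∉ F <;>
        simp only [Set.indicator, Set.mem_inter_iff, Set.mem_ofPred_eq, h1, h2] <;> simp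
    have e2 : ∀ ω : ℕ → V, (if revl ω n = l then (1:ℝ≥0∞) else 0) * ravoid q F j (ω n) =
        ({ω | revl ω n = l}).indicator (fun _ => ravoid q F j (l.headD o)) ω := by
      intro ω
      by_cases h1 : revl ω n = l
      · simp only [Set.indicator, Set.mem_ofPred_eq, h1, if_true, one_mul]
        rw [← h1, revl_headD]
      · simp [Set.indicator, h1]
    simp_rw [e1, e2] at h
    rw [lintegral_indicator_one (hm1.inter hm2), lintegral_indicator hm1, setLIntegral_const] at h
    rw [h, mul_comm]
  rw [ENNReal.mul_iInf (fun ht => absurd ht (measure_ne_top P _))]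
  simp_rw [← hj]
  have hset : ({ω : ℕ → V | revl ω n = l} ∩ {ω | ∀ m, n < m → ω m ∉ F}) =
      ⋂ j, ({ω | revl ω n = l} ∩ {ω | ∀ i < j, ω (n + 1 + i) ∉ F}) := by
    ext ω
    simp only [Set.mem_inter_iff, Set.mem_ofPred_eq, Set.mem_iInter]
    constructor
    · rintro ⟨h1, h2⟩ j
      exact ⟨h1, fun i _ => h2 _ (by omega)⟩
    · intro h
      refine ⟨(h 0).1, fun m hm => ?_⟩
      have := (h (m - n)).2 (m - n - 1) (by omega)
      rwa [show n + 1 + (m - n - 1) = m by omega] at this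
  rw [hset, Antitone.measure_iInter]
  · intro i j hij ω hω
    exact ⟨hω.1, fun i' hi' => hω.2 i' (by omega)⟩
  · intro j
    have : {ω : ℕ → V | ∀ i < j, ω (n + 1 + i) ∉ F} =
        ⋂ i, ⋂ (_ : i < j), {ω | ω (n + 1 + i) ∈ Fᶜ} := by
      ext ω; simp
    refine ((meas_revl hms n l).inter ?_).nullMeasurableSet
    rw [this]
    exact MeasurableSet.iInter fun m => MeasurableSet.iInter fun _ => meas_coord hms _ _
  · exact ⟨0, measure_ne_top P _⟩

lemma last_integral (hms : ∀ s : Set V, MeasurableSet s) (o : V) (q : V → V → ℝ≥0∞)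
    (P : Measure (ℕ → V)) [IsProbabilityMeasure P] (hP : Markov q P) (F : Set V)
    (n : ℕ) (φ : List V → ℝ≥0∞) :
    ∫⁻ ω, φ (revl ω n) * lastI F n ω ∂P =
      ∫⁻ ω, φ (revl ω n) * (if ω n ∈ F then ⨅ j, ravoid q F j (ω n) else 0) ∂P := by
  obtain ⟨u, hu⟩ : ∃ u : V → ℝ≥0∞, ∀ y, u y = if y ∈ F then 1 else 0 := ⟨_, fun _ => rfl⟩
  have e1 : ∀ ω : ℕ → V, φ (revl ω n) * lastI F n ω =
      ({ω | ∀ m, n < m → ω m ∉ F}).indicator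
        (fun ω => φ (revl ω n) * u ((revl ω n).headD o)) ω := by
    intro ω
    simp only [lastI, Set.indicator, Set.mem_ofPred_eq, revl_headD, hu]
    by_cases h1 : ω n ∈ F <;> by_cases h2 : ∀ m, n < m → ω m ∉ F <;>
      simp only [h1, h2] <;> simp
  have e2 : ∀ ω : ℕ → V, φ (revl ω n) * (if ω n ∈ F then ⨅ j, ravoid q F j (ω n) else 0) =
      φ (revl ω n) * (u (ω n) * ⨅ j, ravoid q F j (ω n)) := by
    intro ω
    rw [hu]
    by_cases h1 : ω n ∈ F <;> simp [h1]
  simp_rw [e1, e2]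
  rw [lintegral_indicator (meas_never hms F n),
    lintegral_atoms _ _ (meas_revl hms n) (fun l => φ l * u (l.headD o))]
  have h2 := lintegral_atoms P (fun ω : ℕ → V => revl ω n) (meas_revl hms n)
    (fun l => φ l * (u (l.headD o) * ⨅ j, ravoid q F j (l.headD o)))
  simp only [revl_headD] at h2
  rw [h2]
  refine tsum_congr fun l => ?_
  rw [Measure.restrict_apply (meas_revl hms n l)]
  have := ravoid_antitone_of hms o q P hP F n l
  rw [show (fun ω : ℕ → V => revl ω n) ⁻¹' {l} = {ω | revl ω n = l} from rfl, this]
  ring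

lemma dist_atom (hms : ∀ s : Set V, MeasurableSet s) (o : V) (q k : V → V → ℝ≥0∞)
    (κ M : V → ℝ≥0∞) (P : Measure (ℕ → V)) (hP : Markov q P)
    (hM : ∀ y z, M z * q z y = M y * k y z) (h0 : ∀ y, P {ω | ω 0 = y} = M y * κ y) (n : ℕ) :
    ∀ (y : V) (φ : List V → ℝ≥0∞),
    ∫⁻ ω, φ (revl ω n) * (if ω n = y then 1 else 0) ∂P = M y * I k κ n y φ := by
  induction n with
  | zero =>
    intro y φ
    have h := lintegral_atoms P (fun ω : ℕ → V => ω 0) (fun b => meas_coord hms 0 {b})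
      (fun z => φ [z] * (if z = y then 1 else 0))
    simp only [revl, I]
    rw [h, tsum_eq_single y (by intro b hb; simp [hb]),
      show (fun ω : ℕ → V => ω 0) ⁻¹' {y} = {ω | ω 0 = y} from rfl, h0]
    simp only [if_true]
    ring
  | succ n ih =>
    intro y φ
    have h := markov_step hms o q P hP n (fun y' l => φ (y' :: l) * (if y' = y then 1 else 0))
    simp only [revl, I]
    rw [h]
    have e : ∀ ω : ℕ → V, (∑' y', q (ω n) y' * (φ (y' :: revl ω n) * (if y' = y then 1 else 0)))
        = ∑' z, q z y * (φ (y :: revl ω n) * (if ω n = z then 1 else 0)) := by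
      intro ω
      rw [tsum_eq_single y (by intro b hb; simp [hb]),
        tsum_eq_single (ω n) (by intro b hb; simp [hb.symm])]
      simp
    simp_rw [e]
    have hmeas : ∀ z, Measurable fun ω : ℕ → V =>
        φ (y :: revl ω n) * (if ω n = z then 1 else 0) := fun z =>
      (measurable_revl hms n (fun l => φ (y :: l))).mul
        (measurable_coord hms n (fun w => if w = z then 1 else 0))
    rw [lintegral_tsum (fun z => ((hmeas z).const_mul _).aemeasurable), ← ENNReal.tsum_mul_left]
    refine tsum_congr fun z => ?_
    rw [lintegral_const_mul _ (hmeas z), ih z (fun l => φ (y :: l)), ← mul_assoc, ← mul_assoc,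
      mul_comm (q z y), hM]

lemma dist_general (hms : ∀ s : Set V, MeasurableSet s) (o : V) (q k : V → V → ℝ≥0∞)
    (κ M : V → ℝ≥0∞) (P : Measure (ℕ → V)) (hP : Markov q P)
    (hM : ∀ y z, M z * q z y = M y * k y z) (h0 : ∀ y, P {ω | ω 0 = y} = M y * κ y) (n : ℕ)
    (e : V → ℝ≥0∞) (φ : List V → ℝ≥0∞) :
    ∫⁻ ω, φ (revl ω n) * e (ω n) ∂P = ∑' y, e y * (M y * I k κ n y φ) := by
  have hE : ∀ ω : ℕ → V, φ (revl ω n) * e (ω n) =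
      ∑' y, e y * (φ (revl ω n) * (if ω n = y then 1 else 0)) := by
    intro ω
    rw [tsum_eq_single (ω n) (by intro b hb; simp [hb.symm])]
    simp [mul_comm]
  simp_rw [hE]
  have hmeas : ∀ z, Measurable fun ω : ℕ → V =>
      φ (revl ω n) * (if ω n = z then 1 else 0) := fun z =>
    (measurable_revl hms n φ).mul
      (measurable_coord hms n (fun w => if w = z then 1 else 0))
  rw [lintegral_tsum (fun z => ((hmeas z).const_mul _).aemeasurable)]
  refine tsum_congr fun z => ?_
  rw [lintegral_const_mul _ (hmeas z), dist_atom hms o q k κ M P hP hM h0]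

/-- The value of `φ` at the last exit from `F`. -/
noncomputable def atLast (F : Set V) (φ : List V → ℝ≥0∞) (ω : ℕ → V) : ℝ≥0∞ :=
  ∑' n, φ (revl ω n) * lastI F n ω

lemma measurable_atLast (hms : ∀ s : Set V, MeasurableSet s) (F : Set V)
    (φ : List V → ℝ≥0∞) : Measurable (atLast F φ) := by
  unfold atLast
  exact Measurable.tsum fun n => (measurable_revl hms n φ).mul (measurable_lastI hms F n)

lemma atLast_integral (hms : ∀ s : Set V, MeasurableSet s) (o : V) (q k : V → V → ℝ≥0∞)
    (κ M : V → ℝ≥0∞) (P : Measure (ℕ → V)) [IsProbabilityMeasure P] (hP : Markov q P)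
    (hM : ∀ y z, M z * q z y = M y * k y z) (h0 : ∀ y, P {ω | ω 0 = y} = M y * κ y)
    (F : Set V) (φ : List V → ℝ≥0∞) :
    ∫⁻ ω, atLast F φ ω ∂P = ∑' y, (if y ∈ F then ⨅ j, ravoid q F j y else 0) *
      (M y * ∑' n, I k κ n y φ) := by
  unfold atLast
  have hmeas : ∀ n, Measurable fun ω : ℕ → V => φ (revl ω n) * lastI F n ω := fun n =>
    (measurable_revl hms n φ).mul (measurable_lastI hms F n)
  rw [lintegral_tsum fun n => (hmeas n).aemeasurable]
  simp_rw [last_integral hms o q P hP F _ φ]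
  simp_rw [dist_general hms o q k κ M P hP hM h0 _
    (fun y => if y ∈ F then ⨅ j, ravoid q F j y else 0) φ]
  rw [ENNReal.tsum_comm]
  simp_rw [ENNReal.tsum_mul_left]

lemma atLast_eq (F : Set V) (φ : List V → ℝ≥0∞) (ω : ℕ → V) (L : ℕ) (h1 : ω L ∈ F)
    (h2 : ∀ m, L < m → ω m ∉ F) : atLast F φ ω = φ (revl ω L) := by
  unfold atLast
  rw [tsum_eq_single L]
  · rw [lastI, if_pos ⟨h1, h2⟩, mul_one]
  · intro n hn
    rw [lastI, if_neg, mul_zero]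
    rintro ⟨h3, h4⟩
    rcases lt_or_gt_of_ne hn with h | h
    · exact h4 L h h1
    · exact h2 n h h3

lemma exists_last (F : Set V) (hF : F.Finite) (ω : ℕ → V) (ht : ∀ y, ∀ᶠ n in atTop, ω n ≠ y)
    (n : ℕ) (hn : ω n ∈ F) : ∃ L, n ≤ L ∧ ω L ∈ F ∧ ∀ m, L < m → ω m ∉ F := by
  have hev : ∀ᶠ n in atTop, ω n ∉ F := by
    have := (hF.eventually_all (l := atTop) (p := fun y n => ω n ≠ y)).2 (fun y _ => ht y)
    filter_upwards [this] with n hn hmem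
    exact hn _ hmem rfl
  obtain ⟨B, hB⟩ := eventually_atTop.1 hev
  have hbd : ∀ m, ω m ∈ F → m ≤ B := fun m hm => by
    by_contra hlt
    exact hB m (by omega) hm
  refine ⟨Nat.findGreatest (fun m => ω m ∈ F) B, Nat.le_findGreatest (hbd n hn) hn,
    Nat.findGreatest_spec (P := fun m => ω m ∈ F) (hbd n hn) hn, fun m hm hmF => ?_⟩
  exact Nat.findGreatest_is_greatest hm (hbd m hmF) hmF

lemma atLast_le (F : Set V) (φ : List V → ℝ≥0∞) (B : ℝ≥0∞) (hB : ∀ l, φ l ≤ B) (ω : ℕ → V) :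
    atLast F φ ω ≤ B := by
  by_cases h : ∃ L, ω L ∈ F ∧ ∀ m, L < m → ω m ∉ F
  · obtain ⟨L, h1, h2⟩ := h
    rw [atLast_eq F φ ω L h1 h2]
    exact hB _
  · unfold atLast
    have : ∀ n, lastI F n ω = 0 := fun n => by
      rw [lastI, if_neg]
      exact fun h' => h ⟨n, h'⟩
    simp [this]

end Prob
end DipoleAux

namespace DipoleAux
open scoped ENNReal

section Abstract
set_option linter.unusedSectionVars false
variable {V : Type*} [MeasurableSpace V] [Countable V]

/-- The abstract set-up: killed reversible walk and its `h`-process. -/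
structure Setup (o : V) (k q : V → V → ℝ≥0∞) (κ m h : V → ℝ≥0∞) (P : Measure (ℕ → V)) :
    Prop where
  ms : ∀ s : Set V, MeasurableSet s
  symm : ∀ x y, m x * k x y = m y * k y x
  sub : ∀ x, κ x + ∑' z, k x z ≤ 1
  m0 : ∀ x, m x ≠ 0
  mtop : ∀ x, m x ≠ ∞
  htop : ∀ x, h x ≠ ∞
  ho : h o = 0
  harm : ∀ y, ∑' z, k y z * h z = h y
  hq : ∀ z y, h z * q z y = k z y * h y
  full : ∀ y, y ≠ o → ∑' n, J k κ n y = 1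
  markov : Markov q P
  init : ∀ y, P {ω | ω 0 = y} = (m y * h y) * κ y

variable {o : V} {k q : V → V → ℝ≥0∞} {κ m h : V → ℝ≥0∞} {P : Measure (ℕ → V)}

lemma Setup.hM (S : Setup o k q κ m h P) (y z : V) :
    (m z * h z) * q z y = (m y * h y) * k y z := by
  rw [mul_assoc, S.hq, ← mul_assoc, S.symm]
  ring

lemma Setup.h_ravoid (S : Setup o k q κ m h P) (F : Set V) (j : ℕ) : ∀ y,
    h y * ravoid q F j y = rho k h F j y := by
  induction j with
  | zero => intro y; simp [ravoid, rho]
  | succ j ih =>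
    intro y
    rw [ravoid, rho, ← ENNReal.tsum_mul_left]
    refine tsum_congr fun z => ?_
    rw [← mul_assoc, S.hq]
    by_cases hz : z ∈ F
    · simp [hz]
    · simp only [hz, if_false]
      rw [mul_assoc, ih]

lemma Setup.h_iInf (S : Setup o k q κ m h P) (F : Set V) (y : V) :
    h y * ⨅ j, ravoid q F j y = ⨅ j, rho k h F j y := by
  rw [ENNReal.mul_iInf (fun ht => absurd ht (S.htop y))]
  simp_rw [S.h_ravoid]

/-- Last-exit weights. -/
noncomputable def wt (k : V → V → ℝ≥0∞) (m h : V → ℝ≥0∞) (F : Set V) (y : V) : ℝ≥0∞ :=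
  m y * if y ∈ F then ⨅ j, rho k h F j y else 0

lemma Setup.wt_o (S : Setup o k q κ m h P) (F : Set V) : wt k m h F o = 0 := by
  unfold wt
  split_ifs
  · rw [← S.h_iInf, S.ho]; simp
  · simp

lemma Setup.atLast_int [IsProbabilityMeasure P] (S : Setup o k q κ m h P) (F : Set V)
    (φ : List V → ℝ≥0∞) :
    ∫⁻ ω, atLast F φ ω ∂P = ∑' y, wt k m h F y * ∑' n, I k κ n y φ := by
  rw [atLast_integral S.ms o q k κ (fun y => m y * h y) P S.markov S.hM S.init F φ]
  refine tsum_congr fun y => ?_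
  unfold wt
  by_cases hy : y ∈ F
  · simp only [hy, if_true]
    rw [← S.h_iInf]
    ring
  · simp [hy]

lemma Setup.wt_sum_le [IsProbabilityMeasure P] (S : Setup o k q κ m h P) (F : Set V) :
    ∑' y, wt k m h F y ≤ 1 := by
  have h1 := S.atLast_int F (fun _ => 1)
  have h2 : ∫⁻ ω, atLast F (fun _ => (1:ℝ≥0∞)) ω ∂P ≤ 1 := by
    calc _ ≤ ∫⁻ ω, 1 ∂P := lintegral_mono fun ω => atLast_le F _ 1 (fun _ => le_rfl) ω
      _ = 1 := by simp
  rw [h1] at h2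
  refine le_trans (le_of_eq ?_) h2
  refine tsum_congr fun y => ?_
  by_cases hy : y = o
  · rw [hy, S.wt_o, zero_mul]
  · simp_rw [I_const, mul_one]
    rw [S.full y hy, mul_one]

lemma Setup.crossing_int [IsProbabilityMeasure P] (S : Setup o k q κ m h P) (F : Set V)
    (f : V → ℝ≥0∞) (hf : ∀ y, ∑' z, k y z * f z ≤ f y) (a δ : ℝ≥0∞) :
    δ * ∫⁻ ω, atLast F (cr f a (a + δ) true) ω ∂P ≤ a := by
  rw [S.atLast_int, ← ENNReal.tsum_mul_left]
  calc _ ≤ ∑' y, wt k m h F y * a := by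
        refine ENNReal.tsum_le_tsum fun y => ?_
        rw [mul_left_comm]
        exact mul_le_mul' le_rfl (crossing_tsum k κ S.sub f hf a δ y)
    _ = (∑' y, wt k m h F y) * a := ENNReal.tsum_mul_right
    _ ≤ 1 * a := mul_le_mul' (S.wt_sum_le F) le_rfl
    _ = a := one_mul a

lemma Setup.coord_measure (S : Setup o k q κ m h P) (n : ℕ) (y : V) :
    P {ω | ω n = y} = (m y * h y) * J k κ n y := by
  have h1 := dist_atom S.ms o q k κ (fun y => m y * h y) P S.markov S.hM S.init n y (fun _ => 1)
  rw [I_const, mul_one] at h1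
  rw [← h1]
  have : ∀ ω : ℕ → V, (1:ℝ≥0∞) * (if ω n = y then 1 else 0) =
      ({ω : ℕ → V | ω n = y}).indicator 1 ω := by
    intro ω
    by_cases hω : ω n = y <;> simp [Set.indicator, hω]
  simp_rw [this]
  have hm : MeasurableSet {ω : ℕ → V | ω n = y} := meas_coord S.ms n {y}
  rw [lintegral_indicator_one hm]

lemma Setup.transient (S : Setup o k q κ m h P) :
    ∀ᵐ ω ∂P, ∀ y, ∀ᶠ n in atTop, ω n ≠ y := by
  rw [ae_all_iff]
  intro y
  have hsum : ∑' n, P {ω | ω n = y} ≠ ∞ := by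
    simp_rw [S.coord_measure]
    rw [ENNReal.tsum_mul_left]
    refine ENNReal.mul_ne_top (ENNReal.mul_ne_top (S.mtop y) (S.htop y)) ?_
    exact ne_top_of_le_ne_top ENNReal.one_ne_top (J_tsum_le k κ S.sub y)
  exact ae_eventually_notMem hsum

lemma Setup.avoid_o (S : Setup o k q κ m h P) : ∀ᵐ ω ∂P, ∀ n, ω n ≠ o := by
  rw [ae_all_iff]
  intro n
  have := S.coord_measure n o
  rw [S.ho, mul_zero, zero_mul] at this
  exact measure_eq_zero_iff_ae_notMem.1 this

lemma cr_mono_time (f : V → ℝ≥0∞) (a b : ℝ≥0∞) (hab : a ≤ b) (s : Bool) (ω : ℕ → V) :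
    Monotone fun n => cr f a b s (revl ω n) :=
  monotone_nat_of_le_succ fun n => by
    simp only [revl]
    exact cr_cons_ge f a b hab s _ _

lemma cr_unbounded (f : V → ℝ≥0∞) (a b : ℝ≥0∞) (hab : a ≤ b) (ω : ℕ → V)
    (h1 : ∃ᶠ n in atTop, f (ω n) < a) (h2 : ∃ᶠ n in atTop, b < f (ω n)) (K : ℕ) :
    ∃ n, (K : ℝ≥0∞) ≤ cr f a b true (revl ω n) := by
  induction K with
  | zero => exact ⟨0, by simp⟩
  | succ K ih =>
    obtain ⟨n, hn⟩ := ih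
    obtain ⟨n1, hn1, hb⟩ := frequently_atTop.1 h2 (n + 1)
    obtain ⟨n2, hn2, ha⟩ := frequently_atTop.1 h1 (n1 + 1)
    obtain ⟨n1, rfl⟩ : ∃ j, n1 = j + 1 := ⟨n1 - 1, by omega⟩
    obtain ⟨n2, rfl⟩ : ∃ j, n2 = j + 1 := ⟨n2 - 1, by omega⟩
    refine ⟨n2 + 1, ?_⟩
    calc ((K + 1 : ℕ) : ℝ≥0∞) = 1 + K := by push_cast; ring
      _ ≤ 1 + cr f a b true (revl ω n) := add_le_add le_rfl hn
      _ ≤ 1 + cr f a b true (revl ω n1) :=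
        add_le_add le_rfl (cr_mono_time f a b hab true ω (by omega))
      _ = cr f a b false (revl ω (n1 + 1)) := by simp [revl, cr, hb]
      _ ≤ cr f a b false (revl ω n2) := cr_mono_time f a b hab false ω (by omega)
      _ = cr f a b true (revl ω (n2 + 1)) := by simp [revl, cr, ha]

lemma Setup.no_crossing [IsProbabilityMeasure P] (S : Setup o k q κ m h P)
    (Fs : ℕ → Set V) (hfin : ∀ j, (Fs j).Finite) (hFs : ∀ y, ∀ᶠ j in atTop, y ∈ Fs j)
    (f : V → ℝ≥0∞) (hf : ∀ y, ∑' z, k y z * f z ≤ f y) (a b : ℝ≥0∞) (hab : a < b) :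
    ∀ᵐ ω ∂P, ¬ ((∃ᶠ n in atTop, f (ω n) < a) ∧ ∃ᶠ n in atTop, b < f (ω n)) := by
  obtain ⟨δ, rfl⟩ := exists_add_of_le hab.le
  have hδ : δ ≠ 0 := by rintro rfl; simp at hab
  have ha : a ≠ ∞ := ne_top_of_lt hab
  by_cases hδt : δ = ∞
  · filter_upwards with ω hω
    obtain ⟨n, hn⟩ := hω.2.exists
    simp [hδt] at hn
  have hintg : ∀ j, ∫⁻ ω, atLast (Fs j) (cr f a (a + δ) true) ω ∂P ≤ a / δ := fun j => by
    rw [ENNReal.le_div_iff_mul_le (Or.inl hδ) (Or.inl hδt), mul_comm]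
    exact S.crossing_int (Fs j) f hf a δ
  have hmeas : ∀ j, Measurable (atLast (Fs j) (cr f a (a + δ) true)) :=
    fun j => measurable_atLast S.ms _ _
  have hfatou : ∫⁻ ω, liminf (fun j => atLast (Fs j) (cr f a (a + δ) true) ω) atTop ∂P
      ≤ a / δ := by
    refine (lintegral_liminf_le hmeas).trans ?_
    refine liminf_le_of_frequently_le' (Eventually.frequently (Eventually.of_forall hintg))
  have hlt := ae_lt_top (Measurable.liminf hmeas)
    (ne_top_of_le_ne_top (ENNReal.div_ne_top ha hδ) hfatou)
  filter_upwards [hlt, S.transient] with ω h1 h2 h3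
  refine absurd h1 (not_lt.2 ?_)
  refine ENNReal.le_of_forall_nnreal_lt fun r _ => ?_
  obtain ⟨K, hK⟩ := exists_nat_ge r
  obtain ⟨n, hn⟩ := cr_unbounded f a (a + δ) hab.le ω h3.1 h3.2 K
  refine le_liminf_of_le (by isBoundedDefault) ?_
  filter_upwards [hFs (ω n)] with j hj
  obtain ⟨L, hL, hL1, hL2⟩ := exists_last (Fs j) (hfin j) ω h2 n hj
  rw [atLast_eq _ _ ω L hL1 hL2]
  refine le_trans ?_ (hn.trans (cr_mono_time f a (a + δ) hab.le true ω hL))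
  exact_mod_cast hK

lemma Setup.GK_bound (S : Setup o k q κ m h P) (x : V) (hx : x ≠ o) :
    ∃ B : ℝ≥0∞, B ≠ ∞ ∧ ∀ y, GK k y x ≤ B := by
  have : ∃ n, J k κ n x ≠ 0 := by
    by_contra hcon
    push Not at hcon
    have := S.full x hx
    simp [hcon] at this
  obtain ⟨n, hn⟩ := this
  refine ⟨1 / J k κ n x, ENNReal.div_ne_top ENNReal.one_ne_top hn, fun y => ?_⟩
  have hle : J k κ n x ≤ 1 :=
    (ENNReal.le_tsum n).trans (J_tsum_le k κ S.sub x)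
  rw [ENNReal.le_div_iff_mul_le (Or.inl hn) (Or.inl (ne_top_of_le_ne_top ENNReal.one_ne_top hle))]
  exact GK_mul_J_le k κ S.sub n y x

/-- Green density. -/
noncomputable def gd (k : V → V → ℝ≥0∞) (m : V → ℝ≥0∞) (x y : V) : ℝ≥0∞ := GK k x y / m y

lemma Setup.gd_symm (S : Setup o k q κ m h P) (x y : V) : gd k m x y = gd k m y x := by
  unfold gd
  have := GK_symm k m S.symm x y
  rw [ENNReal.div_eq_div_iff (S.m0 x) (S.mtop x) (S.m0 y) (S.mtop y)]
  exact this

lemma Setup.gd_bound (S : Setup o k q κ m h P) (x : V) (hx : x ≠ o) :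
    ∃ B : ℝ≥0∞, B ≠ ∞ ∧ ∀ y, gd k m x y ≤ B := by
  obtain ⟨B, hB, hle⟩ := S.GK_bound x hx
  refine ⟨B / m x, ENNReal.div_ne_top hB (S.m0 x), fun y => ?_⟩
  rw [S.gd_symm]
  exact ENNReal.div_le_div_right (hle y) _

lemma Setup.gd_left (S : Setup o k q κ m h P) (x y : V) :
    gd k m x y = (if x = y then 1 / m y else 0) + ∑' z, k x z * gd k m z y := by
  unfold gd
  rw [GK_left, ENNReal.add_div]
  congr 1
  · split_ifs <;> simp
  · simp_rw [div_eq_mul_inv, ← ENNReal.tsum_mul_right, mul_assoc]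

lemma Setup.gd_super (S : Setup o k q κ m h P) (x y : V) :
    ∑' z, k y z * gd k m x z ≤ gd k m x y := by
  rw [S.gd_symm x y, S.gd_left y x]
  simp_rw [S.gd_symm x]
  exact le_add_self

lemma Setup.gd_kappa (S : Setup o k q κ m h P) (y : V) (hy : y ≠ o) :
    ∑' x, gd k m x y * (m x * κ x) = 1 := by
  have h1 := GK_J k κ 0 y
  simp only [J, add_zero] at h1
  rw [S.full y hy] at h1
  rw [← h1]
  refine tsum_congr fun x => ?_
  rw [S.gd_symm, gd, ← mul_assoc, ENNReal.div_mul_cancel (S.m0 x) (S.mtop x)]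

lemma Setup.gd_int [IsProbabilityMeasure P] (S : Setup o k q κ m h P) (F : Set V) (hF : F.Finite)
    (x : V) (hxo : x ≠ o) (hx : x ∈ F) :
    ∫⁻ ω, atLast F (fun l => gd k m x (l.headD o)) ω ∂P = h x := by
  rw [S.atLast_int]
  have hG : ∀ y ∈ F, GK k x y * h y ≠ ∞ := by
    intro y _
    by_cases hy : y = o
    · rw [hy, S.ho]; simp
    · obtain ⟨B, hB, hle⟩ := S.GK_bound y hy
      exact ENNReal.mul_ne_top (ne_top_of_le_ne_top hB (hle x)) (S.htop y)
  rw [← last_exit_limit k h S.harm F hF x hx hG]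
  refine tsum_congr fun y => ?_
  simp_rw [I_head]
  rw [ENNReal.tsum_mul_right]
  by_cases hy : y = o
  · subst hy
    rw [S.wt_o, zero_mul]
    have : (if y ∈ F then ⨅ j, rho k h F j y else 0) = 0 := by
      split_ifs
      · rw [← S.h_iInf, S.ho]; simp
      · rfl
    rw [this, mul_zero]
  · rw [S.full y hy, one_mul, wt, gd, mul_comm (m y), mul_assoc,
      ENNReal.mul_div_cancel (S.m0 y) (S.mtop y), mul_comm]

lemma atLast_tendsto (Fs : ℕ → Set V) (hfin : ∀ j, (Fs j).Finite)
    (hFs : ∀ y, ∀ᶠ j in atTop, y ∈ Fs j) (o : V) (u : V → ℝ≥0∞) (ω : ℕ → V)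
    (ht : ∀ y, ∀ᶠ n in atTop, ω n ≠ y) (L : ℝ≥0∞) (hu : Tendsto (fun n => u (ω n)) atTop (𝓝 L)) :
    Tendsto (fun j => atLast (Fs j) (fun l => u (l.headD o)) ω) atTop (𝓝 L) := by
  intro s hs
  obtain ⟨n, hn⟩ := eventually_atTop.1 (hu hs)
  rw [mem_map, mem_atTop_sets]
  obtain ⟨j0, hj0⟩ := eventually_atTop.1 (hFs (ω n))
  refine ⟨j0, fun j hj => ?_⟩
  obtain ⟨M, hM, hM1, hM2⟩ := exists_last (Fs j) (hfin j) ω ht n (hj0 j hj)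
  rw [Set.mem_preimage, atLast_eq _ _ ω M hM1 hM2, revl_headD]
  exact hn M hM

lemma exists_exhaust (o : V) : ∃ Fs : ℕ → Set V, (∀ j, (Fs j).Finite) ∧
    ∀ y, ∀ᶠ j in atTop, y ∈ Fs j := by
  haveI : Nonempty V := ⟨o⟩
  obtain ⟨e, he⟩ := exists_surjective_nat V
  refine ⟨fun j => Set.image e (Set.Iic j), fun j => (Set.finite_Iic j).image e, fun y => ?_⟩
  obtain ⟨i, rfl⟩ := he y
  filter_upwards [eventually_ge_atTop i] with j hj
  exact ⟨i, hj, rfl⟩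

lemma Setup.converge [IsProbabilityMeasure P] (S : Setup o k q κ m h P) :
    ∀ᵐ ω ∂P, ∀ x, ∃ L : ℝ≥0∞, Tendsto (fun n => gd k m x (ω n)) atTop (𝓝 L) := by
  obtain ⟨Fs, hfin, hFs⟩ := exists_exhaust o
  obtain ⟨D, hDc, hDd⟩ := TopologicalSpace.exists_countable_dense ℝ≥0∞
  rw [ae_all_iff]
  intro x
  have : ∀ᵐ ω ∂P, ∀ a ∈ D, ∀ b ∈ D, a < b →
      ¬ ((∃ᶠ n in atTop, gd k m x (ω n) < a) ∧ ∃ᶠ n in atTop, b < gd k m x (ω n)) := by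
    rw [ae_ball_iff hDc]
    intro a _
    rw [ae_ball_iff hDc]
    intro b _
    by_cases hab : a < b
    · filter_upwards [S.no_crossing Fs hfin hFs (gd k m x) (S.gd_super x) a b hab] with ω hω _
      exact hω
    · exact Eventually.of_forall fun ω h => absurd h hab
  filter_upwards [this] with ω hω
  exact tendsto_of_no_upcrossings hDd hω

lemma Setup.expect [IsProbabilityMeasure P] (S : Setup o k q κ m h P) (x : V) (hx : x ≠ o)
    (H : (ℕ → V) → ℝ≥0∞)
    (hH : ∀ᵐ ω ∂P, Tendsto (fun n => gd k m x (ω n)) atTop (𝓝 (H ω))) :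
    ∫⁻ ω, H ω ∂P = h x := by
  obtain ⟨Fs, hfin, hFs⟩ := exists_exhaust o
  obtain ⟨B, hB, hle⟩ := S.gd_bound x hx
  have key := tendsto_lintegral_of_dominated_convergence (μ := P)
    (F := fun j => atLast (Fs j) (fun l => gd k m x (l.headD o))) (f := H) (fun _ => B)
    (fun j => measurable_atLast S.ms _ _)
    (fun j => Eventually.of_forall fun ω => atLast_le _ _ B (fun l => hle _) ω)
    (by simpa using hB)
    (by
      filter_upwards [hH, S.transient] with ω h1 h2
      exact atLast_tendsto Fs hfin hFs o (gd k m x) ω h2 _ h1)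
  refine tendsto_nhds_unique key ?_
  refine tendsto_const_nhds.congr' ?_
  filter_upwards [hFs x] with j hj
  exact (S.gd_int (Fs j) (hfin j) x hx hj).symm

end Abstract
end DipoleAux

namespace DipoleAux
open scoped ENNReal

variable {V : Type*} (N : Network V)

noncomputable def nb (x : V) : Finset V := (N.locFin x).toFinset

theorem c_zero {x y : V} (hy : y ∉ nb N x) : N.c x y = 0 := by
  have h1 : ¬ 0 < N.c x y := by simpa [nb] using hy
  exact le_antisymm (not_lt.1 h1) (N.nonneg x y)

theorem cTot_pos (x : V) : 0 < N.cTot x := N.deg_pos x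

theorem cTot_eq (x : V) : N.cTot x = ∑ y ∈ nb N x, N.c x y :=
  tsum_eq_sum (fun _ hy => c_zero N hy)

theorem p_zero {x y : V} (hy : y ∉ nb N x) : N.p x y = 0 := by
  simp [Network.p, c_zero N hy]

theorem p_zero_left {x y : V} (hx : x ∉ nb N y) : N.p x y = 0 := by
  simp [Network.p, N.symm x y, c_zero N hx]

theorem p_nonneg (x y : V) : 0 ≤ N.p x y := div_nonneg (N.nonneg x y) (cTot_pos N x).le

theorem cTot_mul_p (x y : V) : N.cTot x * N.p x y = N.c x y := by
  have := (cTot_pos N x).ne'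
  unfold Network.p; field_simp

theorem lap_eq (f : V → ℝ) (v : V) : N.lap f v = ∑ x ∈ nb N v, N.c v x * (f x - f v) :=
  tsum_eq_sum (fun x hx => by rw [c_zero N hx, zero_mul])

theorem lap_eq' (f : V → ℝ) (v : V) :
    N.lap f v = ∑ x ∈ nb N v, N.c v x * f x - N.cTot v * f v := by
  rw [lap_eq, cTot_eq, Finset.sum_mul, ← Finset.sum_sub_distrib]
  exact Finset.sum_congr rfl fun _ _ => by ring

theorem lap_eq_p (f : V → ℝ) (v : V) :
    N.lap f v = N.cTot v * (∑ x ∈ nb N v, N.p v x * f x - f v) := by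
  rw [lap_eq', mul_sub, Finset.mul_sum]
  congr 1
  exact Finset.sum_congr rfl fun x _ => by rw [← mul_assoc, cTot_mul_p]

theorem lap_tendsto {F : ℕ → V → ℝ} {f : V → ℝ}
    (hF : ∀ x, Tendsto (fun n => F n x) atTop (𝓝 (f x))) (v : V) :
    Tendsto (fun n => N.lap (F n) v) atTop (𝓝 (N.lap f v)) := by
  simp only [lap_eq]
  exact tendsto_finsetSum _ fun x _ => ((hF x).sub (hF v)).const_mul _

noncomputable def pE (x y : V) : ℝ≥0∞ := ENNReal.ofReal (N.p x y)
noncomputable def pkE (o x y : V) : ℝ≥0∞ := if x = o ∨ y = o then 0 else pE N x y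
noncomputable def kap (o x : V) : ℝ≥0∞ := if x = o then 0 else pE N x o
noncomputable def mE (x : V) : ℝ≥0∞ := ENNReal.ofReal (N.cTot x)

theorem pE_zero {x y : V} (hy : y ∉ nb N x) : pE N x y = 0 := by
  simp [pE, p_zero N hy]

theorem pE_zero_left {x y : V} (hx : x ∉ nb N y) : pE N x y = 0 := by
  simp [pE, p_zero_left N hx]

theorem pE_tsum (x : V) : ∑' y, pE N x y = 1 := by
  rw [tsum_eq_sum (s := nb N x) (fun y hy => pE_zero N hy)]
  unfold pE
  rw [← ENNReal.ofReal_sum_of_nonneg (fun y _ => p_nonneg N x y)]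
  have : ∑ y ∈ nb N x, N.p x y = 1 := by
    simp only [Network.p]
    rw [← Finset.sum_div, ← cTot_eq, div_self (cTot_pos N x).ne']
  simp [this]

theorem mE_mul_pE (x y : V) : mE N x * pE N x y = ENNReal.ofReal (N.c x y) := by
  unfold mE pE
  rw [← ENNReal.ofReal_mul (cTot_pos N x).le, cTot_mul_p]

theorem mE_symm (x y : V) : mE N x * pE N x y = mE N y * pE N y x := by
  rw [mE_mul_pE, mE_mul_pE, N.symm]

theorem pkE_symm (o x y : V) : mE N x * pkE N o x y = mE N y * pkE N o y x := by
  unfold pkE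
  by_cases h1 : x = o
  · simp [h1]
  by_cases h2 : y = o
  · simp [h2]
  simp [h1, h2, mE_symm N x y]

/-- splitting off the root -/
theorem pE_split (o : V) (x : V) (hx : x ≠ o) (f : V → ℝ≥0∞) :
    ∑' z, pE N x z * f z = kap N o x * f o + ∑' z, pkE N o x z * f z := by
  have h1 : ∀ z, pE N x z * f z = (if z = o then kap N o x * f o else 0) + pkE N o x z * f z := by
    intro z
    by_cases hz : z = o
    · subst hz; simp [pkE, kap, hx]
    · simp [pkE, hx, hz]
  rw [tsum_congr h1, ENNReal.tsum_add, tsum_ite_eq]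

theorem pkE_sub (o x : V) : kap N o x + ∑' z, pkE N o x z ≤ 1 := by
  by_cases hx : x = o
  · simp [hx, kap, pkE]
  · have := pE_split N o x hx (fun _ => 1)
    simp only [mul_one] at this
    rw [← this, pE_tsum]

theorem countable (N : Network V) (o : V) : Countable V := by
  let B : ℕ → Set V := fun n => Nat.rec {o} (fun _ s => ⋃ x ∈ s, {y | 0 < N.c x y}) n
  have hB : ∀ n, (B n).Countable := by
    intro n
    induction n with
    | zero => exact Set.countable_singleton o
    | succ n ih => exact ih.biUnion fun x _ => (N.locFin x).countable
  have hall : ∀ y, ∃ n, y ∈ B n := by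
    intro y
    have := N.conn o y
    induction this with
    | refl => exact ⟨0, rfl⟩
    | tail _ hbc ih =>
      obtain ⟨n, hn⟩ := ih
      exact ⟨n + 1, Set.mem_biUnion hn hbc⟩
  have : (Set.univ : Set V) = ⋃ n, B n := by
    ext y; simpa using hall y
  rw [← Set.countable_univ_iff, this]
  exact Set.countable_iUnion hB

section pot
variable {N} {o : V} {h : V → ℝ} (hpot : N.IsPotential o h)

theorem harm_real (hpot : N.IsPotential o h) (v : V) (hv : v ≠ o) :
    ∑ x ∈ nb N v, N.p v x * h x = h v := by
  have h1 := hpot.2.2.2 v hv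
  rw [lap_eq_p] at h1
  have := (mul_eq_zero.1 h1).resolve_left (cTot_pos N v).ne'
  linarith

theorem harm_E (hpot : N.IsPotential o h) (v : V) (hv : v ≠ o) :
    ∑' x, pE N v x * ENNReal.ofReal (h x) = ENNReal.ofReal (h v) := by
  rw [tsum_eq_sum (s := nb N v) (fun y hy => by rw [pE_zero N hy, zero_mul])]
  unfold pE
  rw [← harm_real hpot v hv, ENNReal.ofReal_sum_of_nonneg
    (fun y _ => mul_nonneg (p_nonneg N v y) (hpot.1 y))]
  exact Finset.sum_congr rfl fun y _ => (ENNReal.ofReal_mul (p_nonneg N v y)).symm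

theorem harm_K (hpot : N.IsPotential o h) (v : V) :
    ∑' x, pkE N o v x * ENNReal.ofReal (h x) = ENNReal.ofReal (h v) := by
  by_cases hv : v = o
  · subst hv; simp [pkE, hpot.2.1]
  · have := pE_split N o v hv (fun x => ENNReal.ofReal (h x))
    rw [harm_E hpot v hv] at this
    rw [this]; simp [hpot.2.1]

theorem ph_nonneg (hpot : N.IsPotential o h) (x y : V) : 0 ≤ N.ph h x y :=
  div_nonneg (mul_nonneg (p_nonneg N x y) (hpot.1 y)) (hpot.1 x)

theorem hq_E (hpot : N.IsPotential o h) (z y : V) :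
    ENNReal.ofReal (h z) * ENNReal.ofReal (N.ph h z y) = pkE N o z y * ENNReal.ofReal (h y) := by
  by_cases hz : z = o
  · subst hz; simp [pkE, hpot.2.1]
  by_cases hy : y = o
  · subst hy; simp [pkE, hpot.2.1, Network.ph]
  by_cases h0 : h z = 0
  · have h1 := harm_K hpot z
    rw [h0, ENNReal.ofReal_zero, ENNReal.tsum_eq_zero] at h1
    rw [h1 y, h0]; simp
  · rw [← ENNReal.ofReal_mul (hpot.1 z)]
    simp only [pkE, hz, hy, or_self, if_false, pE]
    rw [← ENNReal.ofReal_mul (p_nonneg N z y)]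
    congr 1
    unfold Network.ph
    field_simp

end pot

/-! recurrence -/

theorem pstep_nonneg (n : ℕ) (x y : V) : 0 ≤ N.pstep n x y := by
  induction n generalizing y with
  | zero => simp only [Network.pstep]; split_ifs <;> norm_num
  | succ n ih => exact tsum_nonneg fun z => mul_nonneg (ih z) (p_nonneg N z y)

theorem pstep_E (n : ℕ) (x y : V) : ENNReal.ofReal (N.pstep n x y) = kpow (pE N) n x y := by
  induction n generalizing y with
  | zero => simp only [Network.pstep, kpow]; split_ifs <;> simp
  | succ n ih =>
    simp only [Network.pstep, kpow]
    rw [ENNReal.ofReal_tsum_of_nonneg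
      (fun z => mul_nonneg (pstep_nonneg N n x z) (p_nonneg N z y))]
    · refine tsum_congr fun z => ?_
      rw [ENNReal.ofReal_mul (pstep_nonneg N n x z), ih]; rfl
    · exact summable_of_ne_finset_zero (s := nb N y)
        (fun z hz => by rw [p_zero_left N hz, mul_zero])

theorem rec_E (hrec : N.Recurrent) (o : V) : ∑' n, kpow (pE N) n o o = ∞ := by
  by_contra hne
  apply hrec o
  have h1 : ∀ n, N.pstep n o o = (kpow (pE N) n o o).toReal := by
    intro n; rw [← pstep_E, ENNReal.toReal_ofReal (pstep_nonneg N n o o)]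
  simp_rw [h1]
  exact ENNReal.summable_toReal hne

/-- the key recurrence lemma: hitting probabilities equal one -/
theorem full_E (hrec : N.Recurrent) (o : V) (y : V) (hy : y ≠ o) :
    ∑' n, J (pkE N o) (kap N o) n y = 1 := by
  set q : V → ℝ≥0∞ := fun z => ∑' n, J (pkE N o) (kap N o) n z with hq
  have hq1 : ∀ z, q z ≤ 1 := fun z => J_tsum_le _ _ (fun x => pkE_sub N o x) z
  obtain ⟨q', hq'⟩ : ∃ q' : V → ℝ≥0∞, ∀ z, q' z = if z = o then 1 else q z := ⟨_, fun _ => rfl⟩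
  have hqo : q' o = 1 := by simp [hq']
  have hqn : ∀ z, z ≠ o → q' z = q z := fun z hz => by simp [hq', hz]
  have hq'1 : ∀ z, q' z ≤ 1 := by
    intro z
    by_cases hz : z = o
    · rw [hz, hqo]
    · rw [hqn z hz]; exact hq1 z
  have hPn : ∀ z, z ≠ o → ∑' w, pE N z w * q' w = q' z := by
    intro z hz
    rw [pE_split N o z hz, hqo, hqn z hz, mul_one, hq]
    simp only
    rw [J_tsum_eq]
    congr 1
    refine tsum_congr fun w => ?_
    by_cases hw : w = o
    · simp [hw, pkE]
    · rw [hqn w hw]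
  have hP1 : ∀ z, ∑' w, pE N z w * q' w ≤ 1 := by
    intro z
    rw [← pE_tsum N z]
    exact ENNReal.tsum_le_tsum fun w => mul_le_of_le_one_right' (hq'1 w)
  set d := 1 - ∑' w, pE N o w * q' w with hd
  have hPo : ∑' w, pE N o w * q' w + d = 1 := add_tsub_cancel_of_le (hP1 o)
  have hb : ∀ n, ∑' y, kpow (pE N) n o y * q' y =
      ∑' y, kpow (pE N) (n + 1) o y * q' y + kpow (pE N) n o o * d := by
    intro n
    have e1 : ∑' y, kpow (pE N) (n + 1) o y * q' y
        = ∑' z, kpow (pE N) n o z * ∑' y, pE N z y * q' y := by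
      simp only [kpow]
      simp_rw [← ENNReal.tsum_mul_right, ← ENNReal.tsum_mul_left]
      rw [ENNReal.tsum_comm]
      simp_rw [mul_assoc]
    have e2 : kpow (pE N) n o o * d = ∑' z, if z = o then kpow (pE N) n o o * d else 0 := by
      rw [tsum_ite_eq]
    rw [e1, e2, ← ENNReal.tsum_add]
    refine tsum_congr fun z => ?_
    by_cases hz : z = o
    · subst hz; rw [if_pos rfl, ← mul_add, hPo, hqo]
    · rw [if_neg hz, add_zero, hPn z hz]
  have hb0 : ∑' y, kpow (pE N) 0 o y * q' y = 1 := by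
    have : ∀ y, kpow (pE N) 0 o y * q' y = if y = o then 1 else 0 := by
      intro y
      by_cases hy : y = o
      · subst hy; simp [kpow, hqo]
      · simp [kpow, hy, Ne.symm hy]
    rw [tsum_congr this, tsum_ite_eq]
  have hbs : ∀ n, ∑' y, kpow (pE N) n o y * q' y +
      (∑ i ∈ Finset.range n, kpow (pE N) i o o) * d = 1 := by
    intro n
    induction n with
    | zero => simpa using hb0
    | succ n ih => rw [← ih, hb n, Finset.sum_range_succ, add_mul]; ring
  have hle : (∑' i, kpow (pE N) i o o) * d ≤ 1 := by
    rw [← ENNReal.tsum_mul_right]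
    refine ENNReal.tsum_le_of_sum_range_le fun n => ?_
    rw [← Finset.sum_mul, ← hbs n]
    exact le_add_self
  have hd0 : d = 0 := by
    by_contra hne
    rw [rec_E N hrec o, ENNReal.top_mul hne] at hle
    simp at hle
  have hP : ∀ z, ∑' w, pE N z w * q' w = q' z := by
    intro z
    by_cases hz : z = o
    · subst hz; rw [hqo, ← hPo, hd0, add_zero]
    · exact hPn z hz
  have hall : ∀ z, q' z = 1 := by
    intro z
    have := N.conn o z
    induction this with
    | refl => exact hqo
    | @tail b c _ hbc ih =>
      by_contra hne
      have hlt : q' c < 1 := lt_of_le_of_ne (hq'1 c) hne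
      have hpc : pE N b c ≠ 0 := by
        unfold pE
        have : 0 < N.p b c := div_pos hbc (cTot_pos N b)
        simpa using this
      have hlt2 : ∑' w, pE N b w * q' w < ∑' w, pE N b w := by
        refine ENNReal.tsum_lt_tsum (i := c) ?_ (fun w => mul_le_of_le_one_right' (hq'1 w)) ?_
        · rw [hP b, ih]; simp
        · have := ENNReal.mul_lt_mul_right hpc (by simp [pE]) hlt
          simpa using this
      rw [hP b, ih, pE_tsum] at hlt2
      exact lt_irrefl _ hlt2
  exact (hqn y hy).symm.trans (hall y)

end DipoleAux

namespace DipoleAux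
open scoped ENNReal

variable {V : Type*}

section chain
variable [MeasurableSpace V] {N : Network V} {o : V} {h : V → ℝ} {P : Measure (ℕ → V)}

theorem chain_markov (hpot : N.IsPotential o h) (hchain : IsChainLaw (N.muh o h) (N.ph h) P) :
    Markov (fun x y => ENNReal.ofReal (N.ph h x y)) P := by
  intro n v
  rw [hchain (n + 1) v, hchain n v, Finset.prod_range_succ, ← mul_assoc, ENNReal.ofReal_mul]
  refine mul_nonneg (mul_nonneg (N.nonneg _ _) (hpot.1 _)) ?_
  exact Finset.prod_nonneg fun i _ => ph_nonneg hpot _ _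

theorem chain_init (hpot : N.IsPotential o h) (hchain : IsChainLaw (N.muh o h) (N.ph h) P)
    (y : V) : P {ω | ω 0 = y} = (mE N y * ENNReal.ofReal (h y)) * kap N o y := by
  have h1 := hchain 0 (fun _ => y)
  have h2 : {ω : ℕ → V | ∀ i ≤ 0, ω i = y} = {ω | ω 0 = y} := by
    ext ω; simp
  rw [h2] at h1
  rw [h1]
  by_cases hy : y = o
  · subst hy; simp [Network.muh, hpot.2.1]
  · simp only [kap, hy, if_false, Finset.range_zero, Finset.prod_empty, mul_one, Network.muh]
    rw [mul_right_comm, mE_mul_pE, ENNReal.ofReal_mul (N.nonneg _ _), N.symm]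

theorem mkSetup [Countable V] (hms : ∀ s : Set V, MeasurableSet s) (hrec : N.Recurrent)
    (hpot : N.IsPotential o h) (hchain : IsChainLaw (N.muh o h) (N.ph h) P) :
    Setup o (pkE N o) (fun x y => ENNReal.ofReal (N.ph h x y)) (kap N o) (mE N)
      (fun x => ENNReal.ofReal (h x)) P where
  ms := hms
  symm := pkE_symm N o
  sub := pkE_sub N o
  m0 := fun x => by simpa [mE] using cTot_pos N x
  mtop := fun x => by simp [mE]
  htop := fun x => by simp
  ho := by simp [hpot.2.1]
  harm := harm_K hpot
  hq := hq_E hpot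
  full := full_E N hrec o
  markov := chain_markov hpot hchain
  init := chain_init hpot hchain

end chain

/-! link with the real-valued Green density -/

theorem avoid_nonneg (N : Network V) (A : Set V) (n : ℕ) (x y : V) : 0 ≤ N.avoid A n x y := by
  induction n generalizing y with
  | zero => simp only [Network.avoid]; split_ifs <;> norm_num
  | succ n ih =>
    simp only [Network.avoid]
    split_ifs
    · exact le_rfl
    · exact tsum_nonneg fun z => mul_nonneg (ih z) (p_nonneg N z y)

theorem avoid_o (N : Network V) (o : V) (n : ℕ) (x : V) : N.avoid {o} n x o = 0 := by
  cases n with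
  | zero =>
    simp only [Network.avoid]
    rw [if_neg]
    rintro ⟨h1, h2⟩
    exact h2 h1
  | succ n => simp [Network.avoid]

theorem avoid_E (N : Network V) (o : V) (n : ℕ) (x y : V) (hy : y ≠ o) :
    ENNReal.ofReal (N.avoid {o} n x y) = kpow (pkE N o) n x y := by
  induction n generalizing y with
  | zero =>
    simp only [Network.avoid, kpow]
    by_cases hxy : x = y
    · subst hxy; simp [hy]
    · simp [hxy]
  | succ n ih =>
    simp only [Network.avoid, kpow]
    rw [if_neg (by simpa using hy), ENNReal.ofReal_tsum_of_nonneg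
      (fun z => mul_nonneg (avoid_nonneg N _ n x z) (p_nonneg N z y))]
    · refine tsum_congr fun z => ?_
      by_cases hz : z = o
      · subst hz; rw [avoid_o]; simp [pkE]
      · rw [ENNReal.ofReal_mul (avoid_nonneg N _ n x z), ih z hz]; simp [pkE, hz, hy, pE]
    · exact summable_of_ne_finset_zero (s := nb N y)
        (fun z hz => by rw [p_zero_left N hz, mul_zero])

theorem g_eq (N : Network V) (o x y : V) (hy : y ≠ o) :
    N.g o x y = (gd (pkE N o) (mE N) x y).toReal := by
  have hk : ∀ n, kpow (pkE N o) n x y ≠ ∞ := fun n => by rw [← avoid_E N o n x y hy]; simp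
  unfold Network.g gd Network.GreenK GK
  rw [ENNReal.toReal_div, ENNReal.tsum_toReal_eq hk]
  congr 1
  · exact tsum_congr fun n => by
      rw [← avoid_E N o n x y hy, ENNReal.toReal_ofReal (avoid_nonneg N _ n x y)]
  · unfold mE; rw [ENNReal.toReal_ofReal (cTot_pos N y).le]

theorem gd_o (N : Network V) (o y : V) (hy : y ≠ o) : gd (pkE N o) (mE N) o y = 0 := by
  unfold gd
  rw [GK_left]
  simp [pkE, Ne.symm hy]

theorem g_nonneg (N : Network V) (o x y : V) : 0 ≤ N.g o x y :=
  div_nonneg (tsum_nonneg fun n => avoid_nonneg N _ n x y) (cTot_pos N y).le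

section setup
variable [MeasurableSpace V] [Countable V] {N : Network V} {o : V} {q : V → V → ℝ≥0∞}
  {hE : V → ℝ≥0∞} {P : Measure (ℕ → V)} [IsProbabilityMeasure P]

theorem gd_bound' (S : Setup o (pkE N o) q (kap N o) (mE N) hE P) (x : V) :
    ∃ B : ℝ≥0∞, B ≠ ∞ ∧ ∀ y, y ≠ o → gd (pkE N o) (mE N) x y ≤ B := by
  by_cases hx : x = o
  · subst hx; exact ⟨0, by simp, fun y hy => (gd_o N x y hy).le⟩
  · obtain ⟨B, h1, h2⟩ := S.gd_bound x hx
    exact ⟨B, h1, fun y _ => h2 y⟩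

theorem g_lap_o (S : Setup o (pkE N o) q (kap N o) (mE N) hE P) (y : V) (hy : y ≠ o) :
    N.lap (fun x => N.g o x y) o = 1 := by
  have h1 := S.gd_kappa y hy
  have hfin : ∀ x, gd (pkE N o) (mE N) x y ≠ ∞ := fun x => by
    obtain ⟨B, hB, h2⟩ := gd_bound' S x
    exact ne_top_of_le_ne_top hB (h2 y hy)
  have h3 : ∀ x, gd (pkE N o) (mE N) x y * (mE N x * kap N o x)
      = ENNReal.ofReal (N.c o x * N.g o x y) := by
    intro x
    rw [ENNReal.ofReal_mul (N.nonneg _ _), g_eq N o x y hy, ENNReal.ofReal_toReal (hfin x)]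
    by_cases hx : x = o
    · subst hx; rw [gd_o N x y hy]; simp
    · simp only [kap, hx, if_false]; rw [mE_mul_pE, N.symm, mul_comm]
  rw [tsum_congr h3, tsum_eq_sum (s := nb N o) (fun x hx => by rw [c_zero N hx]; simp),
    ← ENNReal.ofReal_sum_of_nonneg
      (fun x _ => mul_nonneg (N.nonneg _ _) (g_nonneg N o x y))] at h1
  rw [lap_eq', g_eq N o o y hy, gd_o N o y hy]
  simpa using h1

theorem g_lap (S : Setup o (pkE N o) q (kap N o) (mE N) hE P) (v y : V) (hy : y ≠ o)
    (hv : v ≠ o) (hvy : v ≠ y) :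
    N.lap (fun x => N.g o x y) v = 0 := by
  have h1 := S.gd_left v y
  have hfin : ∀ x, gd (pkE N o) (mE N) x y ≠ ∞ := fun x => by
    obtain ⟨B, hB, h2⟩ := gd_bound' S x
    exact ne_top_of_le_ne_top hB (h2 y hy)
  have hg : ∀ x, gd (pkE N o) (mE N) x y = ENNReal.ofReal (N.g o x y) := fun x => by
    rw [g_eq N o x y hy, ENNReal.ofReal_toReal (hfin x)]
  have h2 := pE_split N o v hv (fun z => gd (pkE N o) (mE N) z y)
  rw [gd_o N o y hy, mul_zero, zero_add] at h2
  rw [if_neg hvy, zero_add, ← h2, tsum_eq_sum (s := nb N v)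
    (fun x hx => by rw [pE_zero N hx]; simp)] at h1
  have h4 : ∀ x ∈ nb N v, pE N v x * gd (pkE N o) (mE N) x y
      = ENNReal.ofReal (N.p v x * N.g o x y) := by
    intro x _
    rw [ENNReal.ofReal_mul (p_nonneg N v x), hg x]; rfl
  rw [Finset.sum_congr rfl h4, ← ENNReal.ofReal_sum_of_nonneg
      (fun x _ => mul_nonneg (p_nonneg N v x) (g_nonneg N o x y)), hg v,
      ENNReal.ofReal_eq_ofReal_iff (g_nonneg N o v y) (Finset.sum_nonneg
      (fun x _ => mul_nonneg (p_nonneg N v x) (g_nonneg N o x y)))] at h1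
  rw [lap_eq_p, ← h1, sub_self, mul_zero]

/-- Part one. -/
theorem part1 (S : Setup o (pkE N o) q (kap N o) (mE N) hE P) :
    ∀ᵐ ω ∂P, ∃ H : V → ℝ, N.IsPotential o H ∧
      ∀ x, Tendsto (fun n => N.g o x (ω n)) atTop (𝓝 (H x)) := by
  filter_upwards [S.transient, S.avoid_o, S.converge] with ω ht ha hc
  choose L hL using hc
  have hLfin : ∀ x, L x ≠ ∞ := by
    intro x
    obtain ⟨B, hB, h2⟩ := gd_bound' S x
    exact ne_top_of_le_ne_top hB (le_of_tendsto' (hL x) fun n => h2 _ (ha n))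
  have hlim : ∀ x, Tendsto (fun n => N.g o x (ω n)) atTop (𝓝 (L x).toReal) := by
    intro x
    have := (ENNReal.tendsto_toReal (hLfin x)).comp (hL x)
    refine this.congr fun n => ?_
    simp [g_eq N o x (ω n) (ha n)]
  refine ⟨fun x => (L x).toReal, ⟨fun v => ENNReal.toReal_nonneg, ?_, ?_, ?_⟩, hlim⟩
  · refine tendsto_nhds_unique (hlim o) ?_
    refine tendsto_const_nhds.congr fun n => ?_
    rw [g_eq N o o (ω n) (ha n), gd_o N o _ (ha n)]; simp
  · refine tendsto_nhds_unique (lap_tendsto N hlim o) ?_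
    exact tendsto_const_nhds.congr fun n => (g_lap_o S (ω n) (ha n)).symm
  · intro v hv
    refine tendsto_nhds_unique (lap_tendsto N hlim v) ?_
    refine tendsto_const_nhds.congr' ?_
    filter_upwards [ht v] with n hn
    exact (g_lap S v (ω n) (ha n) hv (Ne.symm hn)).symm

/-- the limit function -/
noncomputable def Hl (N : Network V) (o x : V) (ω : ℕ → V) : ℝ :=
  limUnder atTop (fun n => N.g o x (ω n))

theorem Hl_ae (S : Setup o (pkE N o) q (kap N o) (mE N) hE P) :
    ∀ᵐ ω ∂P, N.IsPotential o (fun x => Hl N o x ω) ∧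
      ∀ x, Tendsto (fun n => N.g o x (ω n)) atTop (𝓝 (Hl N o x ω)) := by
  filter_upwards [part1 S] with ω ⟨H, h1, h2⟩
  have : H = fun x => Hl N o x ω := by
    funext x; exact ((h2 x).limUnder_eq).symm
  have h3 : ∀ x, H x = Hl N o x ω := fun x => congrFun this x
  refine ⟨this ▸ h1, fun x => h3 x ▸ h2 x⟩

theorem Hl_meas (S : Setup o (pkE N o) q (kap N o) (mE N) hE P) (x : V) :
    AEStronglyMeasurable (Hl N o x) P := by
  refine aestronglyMeasurable_of_tendsto_ae atTop (f := fun n ω => N.g o x (ω n)) ?_ ?_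
  · intro n
    have : Measurable (fun y : V => N.g o x y) := fun s _ => S.ms _
    exact (this.comp (measurable_pi_apply n)).aestronglyMeasurable
  · filter_upwards [Hl_ae S] with ω hω using hω.2 x

theorem Hl_bound (S : Setup o (pkE N o) q (kap N o) (mE N) hE P) (x : V) :
    ∃ B : ℝ, ∀ᵐ ω ∂P, ‖Hl N o x ω‖ ≤ B := by
  obtain ⟨B, hB, h2⟩ := gd_bound' S x
  refine ⟨B.toReal, ?_⟩
  filter_upwards [Hl_ae S, S.avoid_o] with ω hω ha
  rw [Real.norm_of_nonneg (hω.1.1 x)]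
  refine le_of_tendsto' (hω.2 x) fun n => ?_
  rw [g_eq N o x (ω n) (ha n)]
  exact ENNReal.toReal_mono hB (h2 _ (ha n))

theorem Hl_int (S : Setup o (pkE N o) q (kap N o) (mE N) hE P) (x : V) :
    Integrable (Hl N o x) P := by
  obtain ⟨B, hB⟩ := Hl_bound S x
  exact Integrable.of_bound (Hl_meas S x) B hB

theorem Hl_expect (S : Setup o (pkE N o) q (kap N o) (mE N) hE P) (x : V) :
    ∫ ω, Hl N o x ω ∂P = (hE x).toReal := by
  by_cases hx : x = o
  · subst hx
    rw [S.ho, ENNReal.toReal_zero]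
    refine integral_eq_zero_of_ae ?_
    filter_upwards [Hl_ae S] with ω hω using hω.1.2.1
  · rw [integral_eq_lintegral_of_nonneg_ae _ (Hl_meas S x),
      S.expect x hx (fun ω => ENNReal.ofReal (Hl N o x ω))]
    · filter_upwards [Hl_ae S, S.avoid_o] with ω hω ha
      obtain ⟨B, hB, h2⟩ := gd_bound' S x
      refine ((ENNReal.continuous_ofReal.tendsto _).comp (hω.2 x)).congr fun n => ?_
      simp only [Function.comp]
      rw [g_eq N o x (ω n) (ha n), ENNReal.ofReal_toReal]
      exact ne_top_of_le_ne_top hB (h2 _ (ha n))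
    · filter_upwards [Hl_ae S] with ω hω using hω.1.1 x

theorem avg_pot (S : Setup o (pkE N o) q (kap N o) (mE N) hE P)
    (A : Set (ℕ → V)) (hA : P A ≠ 0) :
    N.IsPotential o (fun x => (P.real A)⁻¹ * ∫ ω in A, Hl N o x ω ∂P) := by
  have hA' : P.real A ≠ 0 := by
    rw [Measure.real, ENNReal.toReal_ne_zero]; exact ⟨hA, measure_ne_top _ _⟩
  have hae := ae_restrict_of_ae (s := A) (Hl_ae S)
  have hintg : ∀ x, Integrable (Hl N o x) (P.restrict A) := fun x => (Hl_int S x).restrict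
  have hlap : ∀ v, N.lap (fun x => (P.real A)⁻¹ * ∫ ω in A, Hl N o x ω ∂P) v
      = (P.real A)⁻¹ * ∫ ω in A, N.lap (fun x => Hl N o x ω) v ∂P := by
    intro v
    simp only [lap_eq]
    have hi : ∀ x ∈ nb N v, Integrable (fun ω => N.c v x * (Hl N o x ω - Hl N o v ω))
        (P.restrict A) := fun x _ => ((hintg x).sub (hintg v)).const_mul _
    rw [integral_finsetSum _ hi, Finset.mul_sum]
    refine Finset.sum_congr rfl fun x _ => ?_
    rw [integral_const_mul, integral_sub (hintg x) (hintg v)]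
    ring
  refine ⟨fun v => ?_, ?_, ?_, ?_⟩
  · refine mul_nonneg (inv_nonneg.2 measureReal_nonneg) (integral_nonneg_of_ae ?_)
    filter_upwards [hae] with ω hω using hω.1.1 v
  · have : ∫ ω in A, Hl N o o ω ∂P = 0 := by
      refine integral_eq_zero_of_ae ?_
      filter_upwards [hae] with ω hω using hω.1.2.1
    simp [this]
  · rw [hlap]
    have : ∫ ω in A, N.lap (fun x => Hl N o x ω) o ∂P = ∫ ω in A, (1 : ℝ) ∂P := by
      refine integral_congr_ae ?_
      filter_upwards [hae] with ω hω using hω.1.2.2.1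
    rw [this]
    simp [hA']
  · intro v hv
    rw [hlap]
    have : ∫ ω in A, N.lap (fun x => Hl N o x ω) v ∂P = 0 := by
      refine integral_eq_zero_of_ae ?_
      filter_upwards [hae] with ω hω using hω.1.2.2.2 v hv
    simp [this]

theorem part3 (S : Setup o (pkE N o) q (kap N o) (mE N) hE P)
    (h : V → ℝ) (hh : ∀ x, ∫ ω, Hl N o x ω ∂P = h x)
    (hext : ∀ (h₁ h₂ : V → ℝ) (t : ℝ), N.IsPotential o h₁ → N.IsPotential o h₂ →
        0 < t → t < 1 → h = (fun x => t * h₁ x + (1 - t) * h₂ x) → h₁ = h₂) :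
    ∀ᵐ ω ∂P, ∀ x, Tendsto (fun n => N.g o x (ω n)) atTop (𝓝 (h x)) := by
  have key : ∀ x, Hl N o x =ᵐ[P] fun _ => h x := by
    intro x
    refine Integrable.ae_eq_of_forall_setIntegral_eq _ _ (Hl_int S x) (integrable_const _) ?_
    intro A hA _
    by_cases hA0 : P A = 0
    · rw [setIntegral_measure_zero _ hA0, setIntegral_measure_zero _ hA0]
    have hsplit : ∀ z, ∫ ω in A, Hl N o z ω ∂P + ∫ ω in Aᶜ, Hl N o z ω ∂P = h z := fun z => by
      rw [integral_add_compl hA (Hl_int S z), hh]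
    have hsum : P.real A + P.real Aᶜ = 1 := by
      rw [measureReal_add_measureReal_compl hA]; simp
    have hr : ∫ _ in A, h x ∂P = P.real A * h x := by simp
    rw [hr]
    by_cases hA1 : P Aᶜ = 0
    · have h1 : P.real Aᶜ = 0 := by simp [Measure.real, hA1]
      have h2 := hsplit x
      rw [setIntegral_measure_zero _ hA1, add_zero] at h2
      rw [h2]
      have : P.real A = 1 := by linarith
      rw [this, one_mul]
    have hpA : 0 < P.real A := ENNReal.toReal_pos hA0 (measure_ne_top _ _)
    have hpAc : 0 < P.real Aᶜ := ENNReal.toReal_pos hA1 (measure_ne_top _ _)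
    have heq := hext _ _ (P.real A) (avg_pot S A hA0) (avg_pot S Aᶜ hA1) hpA (by linarith) (by
      funext z
      have : 1 - P.real A = P.real Aᶜ := by linarith
      rw [this, ← mul_assoc, ← mul_assoc, mul_inv_cancel₀ hpA.ne', mul_inv_cancel₀ hpAc.ne',
        one_mul, one_mul, hsplit])
    have h3 := congrFun heq x
    have h4 := hsplit x
    set a := ∫ ω in A, Hl N o x ω ∂P
    set b := ∫ ω in Aᶜ, Hl N o x ω ∂P
    have h5 : a * P.real Aᶜ = b * P.real A := by
      field_simp at h3
      linarith
    have h6 : P.real Aᶜ = 1 - P.real A := by linarith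
    rw [h6] at h5
    rw [← h4]; linarith
  filter_upwards [Hl_ae S, ae_all_iff.2 key] with ω h1 h2 x
  have := h1.2 x
  rwa [h2 x] at this

end setup

end DipoleAux

/-- Convergence of dipoles along the `h`-process: almost surely the dipoles
`g_o(·, Y_n)` converge pointwise to a random potential `H`, with `E[H(x)] = h(x)`; and if
`h` is extremal then `H = h` almost surely. -/
theorem dipoles_converge_along_hprocess {V : Type*} [MeasurableSpace V]
    (hms : ∀ s : Set V, MeasurableSet s)
    (N : Network V) (hrec : N.Recurrent) (o : V) (h : V → ℝ) (hpot : N.IsPotential o h)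
    (P : MeasureTheory.Measure (ℕ → V)) [MeasureTheory.IsProbabilityMeasure P]
    (hchain : IsChainLaw (N.muh o h) (N.ph h) P) :
    (∀ᵐ ω ∂P, ∃ H : V → ℝ, N.IsPotential o H ∧
        ∀ x, Filter.Tendsto (fun n => N.g o x (ω n)) Filter.atTop (nhds (H x))) ∧
    (∀ x, (∫ ω, limUnder Filter.atTop (fun n => N.g o x (ω n)) ∂P) = h x) ∧
    ((∀ (h₁ h₂ : V → ℝ) (t : ℝ), N.IsPotential o h₁ → N.IsPotential o h₂ →
        0 < t → t < 1 → h = (fun x => t * h₁ x + (1 - t) * h₂ x) → h₁ = h₂) →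
      ∀ᵐ ω ∂P, ∀ x, Filter.Tendsto (fun n => N.g o x (ω n)) Filter.atTop (nhds (h x))) := by
  have : Countable V := DipoleAux.countable N o
  have S := DipoleAux.mkSetup hms hrec hpot hchain
  have hE : ∀ x, ∫ ω, DipoleAux.Hl N o x ω ∂P = h x := fun x => by
    rw [DipoleAux.Hl_expect S x, ENNReal.toReal_ofReal (hpot.1 x)]
  exact ⟨DipoleAux.part1 S, hE, fun hext => DipoleAux.part3 S h hE hext⟩
end
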